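/- For every β ∈ (1,2), for μ_β-a.e. x ∈ ℝ, liminf_{r→0⁺} log μ_β(B̄(x,r)) / log r ≥ 0.98040856. (Equivalently, the dimension of every Bernoulli convolution μ_β with β ∈ (1,2) is at least 0.98040856.) -/

import Mathlib

open MeasureTheory Filter Topology

/-- `m` is the infinite product on `{0,1}^ℕ` of the uniform measure on two points:
every cylinder of length `n` has mass `2⁻ⁿ`. -/
def IsCoinMeasure (m : Measure (ℕ → Fin 2)) : Prop :=
  IsProbabilityMeasure m ∧
  ∀ (n : ℕ) (w : Fin n → Fin 2),
    m {x | ∀ j : Fin n, x j.1 = w j} = (2 : ENNReal)⁻¹ ^ n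

/-- The coding map `π_β(ε) = (1 - 1/β) ∑_{n≥0} ε_n β^{-n}` of the Bernoulli convolution. -/
noncomputable def piBeta (β : ℝ) (x : ℕ → Fin 2) : ℝ :=
  (1 - 1/β) * ∑' n : ℕ, ((x n : ℕ) : ℝ) / β ^ n

open scoped ENNReal
/-- The fair measure on two points. -/
noncomputable def fairBit : Measure (Fin 2) := ProbabilityTheory.uniformOn Set.univ

instance : IsProbabilityMeasure fairBit := by
  unfold fairBit; infer_instance

theorem fairBit_singleton (a : Fin 2) : fairBit {a} = 2⁻¹ := by
  simp [fairBit, ProbabilityTheory.uniformOn_univ]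

/-- The fair coin-tossing measure. -/
noncomputable def coin : Measure (ℕ → Fin 2) := Measure.infinitePi (fun _ => fairBit)

instance : IsProbabilityMeasure coin := by
  unfold coin; infer_instance

theorem isCoinMeasure_coin : IsCoinMeasure coin := by
  refine ⟨inferInstance, fun n w => ?_⟩
  have h := Measure.infinitePi_pi (μ := fun _ : ℕ => fairBit) (s := Finset.range n)
    (t := fun i => if h : i < n then {w ⟨i, h⟩} else Set.univ) (fun _ _ => .of_discrete)
  have hs : {x : ℕ → Fin 2 | ∀ j : Fin n, x j.1 = w j} =
      Set.pi (Finset.range n) (fun i => if h : i < n then {w ⟨i, h⟩} else Set.univ) := by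
    ext x
    simp only [Set.mem_ofPred_eq, Set.mem_pi, Finset.coe_range, Set.mem_Iio]
    constructor
    · intro hx i hi
      simpa [hi] using hx ⟨i, hi⟩
    · intro hx j
      simpa [j.2] using hx j.1 j.2
  rw [coin, hs, h, Finset.prod_congr rfl (g := fun _ => (2 : ℝ≥0∞)⁻¹)]
  · simp
  · intro i hi
    simp [Finset.mem_range.1 hi, fairBit_singleton]

/-- The cylinder of length `n` determined by a word. -/
def wordCylinder (n : ℕ) (w : Fin n → Fin 2) : Set (ℕ → Fin 2) := {x | ∀ j : Fin n, x j.1 = w j}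

theorem measurableSet_wordCylinder (n : ℕ) (w : Fin n → Fin 2) :
    MeasurableSet (wordCylinder n w) := by
  have : wordCylinder n w = ⋂ j : Fin n, (fun x : ℕ → Fin 2 => x j.1) ⁻¹' {w j} := by
    ext x; simp [wordCylinder]
  rw [this]
  exact MeasurableSet.iInter fun j => (measurable_pi_apply _) (measurableSet_singleton _)

theorem generateFrom_wordCylinder :
    (inferInstance : MeasurableSpace (ℕ → Fin 2)) =
      MeasurableSpace.generateFrom {s | ∃ n w, s = wordCylinder n w} := by
  apply le_antisymm
  · refine iSup_le fun i => ?_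
    rintro s ⟨t, -, rfl⟩
    have : (fun x : ℕ → Fin 2 => x i) ⁻¹' t =
        ⋃ w ∈ {w : Fin (i + 1) → Fin 2 | w (Fin.last i) ∈ t}, wordCylinder (i + 1) w := by
      ext x
      simp only [Set.mem_preimage, Set.mem_iUnion, Set.mem_ofPred_eq, wordCylinder]
      constructor
      · intro hx
        exact ⟨fun j => x j.1, hx, fun j => rfl⟩
      · rintro ⟨w, hw, hx⟩
        rw [← hx (Fin.last i)] at hw
        exact hw
    change MeasurableSet[MeasurableSpace.generateFrom {s | ∃ n w, s = wordCylinder n w}]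
      ((fun x : ℕ → Fin 2 => x i) ⁻¹' t)
    rw [this]
    refine @MeasurableSet.biUnion _ _ (_) _ _ (Set.to_countable _) fun w _ => ?_
    exact MeasurableSpace.measurableSet_generateFrom ⟨_, w, rfl⟩
  · refine MeasurableSpace.generateFrom_le ?_
    rintro s ⟨n, w, rfl⟩
    exact measurableSet_wordCylinder n w

theorem isPiSystem_wordCylinder : IsPiSystem {s | ∃ n w, s = wordCylinder n w} := by
  have key : ∀ n w n' w', n ≤ n' → (wordCylinder n w ∩ wordCylinder n' w').Nonempty →
      wordCylinder n w ∩ wordCylinder n' w' = wordCylinder n' w' := by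
    rintro n w n' w' hn ⟨x, hx, hx'⟩
    refine Set.inter_eq_right.2 fun y hy j => ?_
    rw [← hx j, hy ⟨j.1, j.2.trans_le hn⟩, hx' ⟨j.1, j.2.trans_le hn⟩]
  rintro s ⟨n, w, rfl⟩ t ⟨n', w', rfl⟩ hne
  rcases le_total n n' with h | h
  · exact ⟨n', w', key n w n' w' h hne⟩
  · rw [Set.inter_comm] at hne ⊢
    exact ⟨n, w, key n' w' n w h hne⟩

theorem IsCoinMeasure.eq_coin {m : Measure (ℕ → Fin 2)} (hm : IsCoinMeasure m) : m = coin := by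
  have := hm.1
  refine ext_of_generate_finite _ generateFrom_wordCylinder isPiSystem_wordCylinder ?_ (by simp)
  rintro s ⟨n, w, rfl⟩
  exact (hm.2 n w).trans (isCoinMeasure_coin.2 n w).symm

/-- Prepend a digit to a sequence. -/
def consDigit (a : Fin 2) (x : ℕ → Fin 2) : ℕ → Fin 2 := fun n => Nat.casesOn n a x

/-- The left shift. -/
def shift (x : ℕ → Fin 2) : ℕ → Fin 2 := fun n => x (n + 1)

/-- Exchange the two digits. -/
def flipDigits (x : ℕ → Fin 2) : ℕ → Fin 2 := fun n => 1 - x n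

@[simp] theorem shift_consDigit (a : Fin 2) (x : ℕ → Fin 2) : shift (consDigit a x) = x := rfl
@[simp] theorem consDigit_zero (a : Fin 2) (x : ℕ → Fin 2) : consDigit a x 0 = a := rfl
@[simp] theorem consDigit_succ (a : Fin 2) (x : ℕ → Fin 2) (n : ℕ) :
    consDigit a x (n + 1) = x n := rfl

theorem measurable_consDigit (a : Fin 2) : Measurable (consDigit a) := by
  refine measurable_pi_lambda _ fun n => ?_
  cases n with
  | zero => exact measurable_const
  | succ n => exact measurable_pi_apply n

theorem measurable_shift : Measurable shift :=
  measurable_pi_lambda _ fun n => measurable_pi_apply (n + 1)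

theorem measurable_flipDigits : Measurable flipDigits :=
  measurable_pi_lambda _ fun n =>
    (measurable_of_finite (fun a : Fin 2 => 1 - a)).comp (measurable_pi_apply n)

theorem coin_eq_consDigit :
    coin = (2 : ℝ≥0∞)⁻¹ • coin.map (consDigit 0) + (2 : ℝ≥0∞)⁻¹ • coin.map (consDigit 1) := by
  symm
  apply IsCoinMeasure.eq_coin
  have hprob (a) : IsProbabilityMeasure (coin.map (consDigit a)) :=
    Measure.isProbabilityMeasure_map (measurable_consDigit a).aemeasurable
  refine ⟨⟨?_⟩, fun n w => ?_⟩
  · have := hprob 0; have := hprob 1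
    simp [ENNReal.inv_two_add_inv_two]
  · change ((2 : ℝ≥0∞)⁻¹ • coin.map (consDigit 0) + (2 : ℝ≥0∞)⁻¹ • coin.map (consDigit 1))
      (wordCylinder n w) = _
    have hcyl : ∀ a, coin.map (consDigit a) (wordCylinder n w) =
        coin (consDigit a ⁻¹' wordCylinder n w) :=
      fun a => Measure.map_apply (measurable_consDigit a) (measurableSet_wordCylinder n w)
    simp only [Measure.add_apply, Measure.smul_apply, smul_eq_mul, hcyl]
    cases n with
    | zero =>
      have : wordCylinder 0 w = Set.univ := by ext x; simp [wordCylinder]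
      simp [this, ENNReal.inv_two_add_inv_two]
    | succ n =>
      have h1 : ∀ a, coin (consDigit a ⁻¹' wordCylinder (n + 1) w) =
          if w 0 = a then (2 : ℝ≥0∞)⁻¹ ^ n else 0 := by
        intro a
        split_ifs with h
        · rw [← isCoinMeasure_coin.2 n (fun j => w j.succ)]
          congr 1
          ext x
          simp only [wordCylinder, Set.mem_preimage, Set.mem_ofPred_eq]
          rw [Fin.forall_fin_succ]
          simp [h]
        · convert measure_empty (μ := coin)
          ext x
          simp only [wordCylinder, Set.mem_preimage, Set.mem_ofPred_eq, Set.mem_empty_iff_false,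
            iff_false]
          exact fun hx => h (hx 0).symm
      rw [h1, h1, pow_succ']
      rcases Fin.exists_fin_two.1 ⟨w 0, rfl⟩ with h | h <;> simp [h]

theorem lintegral_coin {f : (ℕ → Fin 2) → ℝ≥0∞} (hf : Measurable f) :
    ∫⁻ x, f x ∂coin =
      2⁻¹ * ∫⁻ x, f (consDigit 0 x) ∂coin + 2⁻¹ * ∫⁻ x, f (consDigit 1 x) ∂coin := by
  conv_lhs => rw [coin_eq_consDigit]
  rw [lintegral_add_measure, lintegral_smul_measure, lintegral_smul_measure,
    lintegral_map hf (measurable_consDigit 0), lintegral_map hf (measurable_consDigit 1)]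
  rfl

theorem map_shift_coin : coin.map shift = coin := by
  ext s hs
  rw [Measure.map_apply measurable_shift hs]
  conv_lhs => rw [coin_eq_consDigit]
  simp only [Measure.add_apply, Measure.smul_apply, smul_eq_mul]
  rw [Measure.map_apply (measurable_consDigit 0) (measurable_shift hs),
    Measure.map_apply (measurable_consDigit 1) (measurable_shift hs)]
  have : ∀ a, consDigit a ⁻¹' (shift ⁻¹' s) = s := fun a => by ext x; simp
  rw [this, this, ← add_mul, ENNReal.inv_two_add_inv_two, one_mul]

theorem map_flipDigits_coin : coin.map flipDigits = coin := by
  apply IsCoinMeasure.eq_coin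
  refine ⟨Measure.isProbabilityMeasure_map measurable_flipDigits.aemeasurable, fun n w => ?_⟩
  rw [← isCoinMeasure_coin.2 n (fun j => 1 - w j)]
  change coin.map flipDigits (wordCylinder n w) = _
  rw [Measure.map_apply measurable_flipDigits (measurableSet_wordCylinder n w)]
  congr 1
  ext x
  simp only [wordCylinder, Set.mem_preimage, Set.mem_ofPred_eq]
  refine forall_congr' fun j => ?_
  change 1 - x j = w j ↔ x j = 1 - w j
  generalize x j = a
  generalize w j = b
  revert a b
  decide

/-- Interleave two sequences. -/
def interleave (p : (ℕ → Fin 2) × (ℕ → Fin 2)) : ℕ → Fin 2 :=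
  fun n => if n % 2 = 0 then p.1 (n / 2) else p.2 (n / 2)

theorem measurable_interleave : Measurable interleave := by
  refine measurable_pi_lambda _ fun n => ?_
  unfold interleave
  split_ifs
  · exact (measurable_pi_apply _).comp measurable_fst
  · exact (measurable_pi_apply _).comp measurable_snd

theorem map_interleave_coin : (coin.prod coin).map interleave = coin := by
  refine Measure.eq_infinitePi (μ := fun _ => fairBit) fun s t ht => ?_
  rw [Measure.map_apply measurable_interleave
    (MeasurableSet.pi (Finset.countable_toSet s) fun i _ => ht i)]
  have hinj : ∀ r, Set.InjOn (fun n => n / 2) (s.filter (fun n => n % 2 = r)) := by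
    intro r a ha b hb hab
    simp only [Finset.coe_filter, Set.mem_ofPred_eq] at ha hb hab
    omega
  have hpre : interleave ⁻¹' (Set.pi s t) =
      (Set.pi ((s.filter (fun n => n % 2 = 0)).image (fun n => n / 2) : Finset ℕ)
        (fun n => t (2 * n))) ×ˢ
      (Set.pi ((s.filter (fun n => n % 2 = 1)).image (fun n => n / 2) : Finset ℕ)
        (fun n => t (2 * n + 1))) := by
    ext p
    simp only [Set.mem_preimage, Set.mem_pi, Set.mem_prod, Finset.mem_coe, Finset.mem_image,
      Finset.mem_filter, interleave]
    constructor
    · intro h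
      refine ⟨?_, ?_⟩
      · rintro i ⟨n, ⟨hn, hr⟩, rfl⟩
        have := h n hn
        rw [if_pos hr] at this
        rwa [show 2 * (n / 2) = n by omega]
      · rintro i ⟨n, ⟨hn, hr⟩, rfl⟩
        have := h n hn
        rw [if_neg (by omega)] at this
        rwa [show 2 * (n / 2) + 1 = n by omega]
    · rintro ⟨h0, h1⟩ n hn
      split_ifs with hr
      · have := h0 (n / 2) ⟨n, ⟨hn, hr⟩, rfl⟩
        rwa [show 2 * (n / 2) = n by omega] at this
      · have := h1 (n / 2) ⟨n, ⟨hn, by omega⟩, rfl⟩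
        rwa [show 2 * (n / 2) + 1 = n by omega] at this
  rw [hpre, Measure.prod_prod, coin, Measure.infinitePi_pi _ (fun _ _ => ht _),
    Measure.infinitePi_pi _ (fun _ _ => ht _), Finset.prod_image (hinj 0),
    Finset.prod_image (hinj 1)]
  rw [← Finset.prod_filter_mul_prod_filter_not s (fun n => n % 2 = 0)]
  congr 1
  · refine Finset.prod_congr rfl fun n hn => ?_
    rw [show 2 * (n / 2) = n by have := (Finset.mem_filter.1 hn).2; omega]
  · rw [Finset.filter_congr (q := fun n => ¬ n % 2 = 0) (fun n _ => by omega)]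
    refine Finset.prod_congr rfl fun n hn => ?_
    rw [show 2 * (n / 2) + 1 = n by have := (Finset.mem_filter.1 hn).2; omega]

theorem summable_piBeta {β : ℝ} (hβ : 1 < β) (x : ℕ → Fin 2) :
    Summable fun n : ℕ => ((x n : ℕ) : ℝ) / β ^ n := by
  have hb : (0 : ℝ) < β := by linarith
  refine Summable.of_nonneg_of_le (fun n => by positivity) (fun n => ?_)
    (summable_geometric_of_lt_one (r := β⁻¹) (by positivity) (inv_lt_one_of_one_lt₀ hβ))
  rw [inv_pow, div_eq_mul_inv]
  have : ((x n : ℕ) : ℝ) ≤ 1 := by exact_mod_cast Nat.lt_succ_iff.1 (x n).2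
  exact mul_le_of_le_one_left (by positivity) this

theorem tsum_inv_pow {β : ℝ} (hβ : 1 < β) : (1 - 1 / β) * ∑' n : ℕ, 1 / β ^ n = 1 := by
  have hb : (0 : ℝ) < β := by linarith
  have h := tsum_geometric_of_lt_one (r := β⁻¹) (by positivity) (inv_lt_one_of_one_lt₀ hβ)
  have h' : (∑' n : ℕ, 1 / β ^ n) = ∑' n : ℕ, (β⁻¹) ^ n := by simp [one_div]
  have : 1 - β⁻¹ ≠ 0 := by have := inv_lt_one_of_one_lt₀ hβ; linarith
  rw [h', h, one_div, mul_inv_cancel₀ this]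

theorem one_sub_one_div_pos {β : ℝ} (hβ : 1 < β) : 0 < 1 - 1 / β := by
  have := inv_lt_one_of_one_lt₀ hβ
  rw [one_div]; linarith

theorem piBeta_nonneg {β : ℝ} (hβ : 1 < β) (x : ℕ → Fin 2) : 0 ≤ piBeta β x := by
  have hb : (0 : ℝ) < β := by linarith
  exact mul_nonneg (one_sub_one_div_pos hβ).le (tsum_nonneg fun n => by positivity)

theorem piBeta_flipDigits {β : ℝ} (hβ : 1 < β) (x : ℕ → Fin 2) :
    piBeta β (flipDigits x) = 1 - piBeta β x := by
  have hb : (0 : ℝ) < β := by linarith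
  rw [eq_sub_iff_add_eq, piBeta, piBeta, ← mul_add,
    ← (summable_piBeta hβ _).tsum_add (summable_piBeta hβ _)]
  refine Eq.trans ?_ (tsum_inv_pow hβ)
  congr 2
  funext n
  rw [← add_div]
  congr 1
  have : ∀ a : Fin 2, (((1 - a : Fin 2) : ℕ) : ℝ) + ((a : ℕ) : ℝ) = 1 := by
    intro a; fin_cases a <;> simp
  exact this (x n)

theorem piBeta_le_one {β : ℝ} (hβ : 1 < β) (x : ℕ → Fin 2) : piBeta β x ≤ 1 := by
  have := piBeta_flipDigits hβ x
  have := piBeta_nonneg hβ (flipDigits x)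
  linarith

theorem piBeta_shift {β : ℝ} (hβ : 1 < β) (x : ℕ → Fin 2) :
    piBeta β x = (1 - 1 / β) * ((x 0 : ℕ) : ℝ) + piBeta β (shift x) / β := by
  have hb : (0 : ℝ) < β := by linarith
  rw [piBeta, (summable_piBeta hβ x).tsum_eq_zero_add, piBeta, mul_add, mul_div_assoc,
    ← tsum_div_const]
  simp only [pow_zero, div_one, shift]
  congr 3
  funext n
  rw [pow_succ, div_div]

theorem piBeta_consDigit {β : ℝ} (hβ : 1 < β) (a : Fin 2) (x : ℕ → Fin 2) :
    piBeta β (consDigit a x) = (1 - 1 / β) * ((a : ℕ) : ℝ) + piBeta β x / β := by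
  rw [piBeta_shift hβ]; rfl

theorem abs_piBeta_sub_le {β : ℝ} (hβ : 1 < β) (n : ℕ) (x y : ℕ → Fin 2)
    (h : ∀ i < n, x i = y i) : |piBeta β x - piBeta β y| ≤ β⁻¹ ^ n := by
  have hb : (0 : ℝ) < β := by linarith
  induction n generalizing x y with
  | zero =>
    rw [pow_zero, abs_le]
    constructor <;> linarith [piBeta_nonneg hβ x, piBeta_nonneg hβ y, piBeta_le_one hβ x,
      piBeta_le_one hβ y]
  | succ n ih =>
    rw [piBeta_shift hβ x, piBeta_shift hβ y, h 0 (by omega), add_sub_add_left_eq_sub, ← sub_div,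
      abs_div, abs_of_pos hb, pow_succ, ← div_eq_mul_inv]
    gcongr
    exact ih _ _ fun i hi => h (i + 1) (by omega)

theorem continuous_piBeta {β : ℝ} (hβ : 1 < β) : Continuous (piBeta β) := by
  have hb : (0 : ℝ) < β := by linarith
  unfold piBeta
  refine continuous_const.mul (continuous_tsum (u := fun n => β⁻¹ ^ n) (fun n => ?_) ?_ ?_)
  · have : Continuous fun a : Fin 2 => ((a : ℕ) : ℝ) := continuous_of_discreteTopology
    exact (this.comp (continuous_apply n)).div_const _
  · exact summable_geometric_of_lt_one (by positivity) (inv_lt_one_of_one_lt₀ hβ)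
  · intro n x
    have : ((x n : ℕ) : ℝ) ≤ 1 := by exact_mod_cast Nat.lt_succ_iff.1 (x n).2
    rw [Real.norm_of_nonneg (by positivity), inv_pow, div_eq_mul_inv]
    exact mul_le_of_le_one_left (by positivity) this

theorem measurable_piBeta {β : ℝ} (hβ : 1 < β) : Measurable (piBeta β) :=
  (continuous_piBeta hβ).measurable

theorem piBeta_interleave {β : ℝ} (hβ : 1 < β) (p : (ℕ → Fin 2) × (ℕ → Fin 2)) :
    piBeta β (interleave p) = (1 - 1 / β) / (1 - 1 / β ^ 2) *
      (piBeta (β ^ 2) p.1 + piBeta (β ^ 2) p.2 / β) := by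
  have hb : (0 : ℝ) < β := by linarith
  have hβ2 : 1 < β ^ 2 := by nlinarith
  have h0 := (one_sub_one_div_pos hβ2).ne'
  have he : ∀ k, (((interleave p (2 * k) : Fin 2) : ℕ) : ℝ) / β ^ (2 * k) =
      ((p.1 k : ℕ) : ℝ) / (β ^ 2) ^ k := by
    intro k
    have : interleave p (2 * k) = p.1 k := by simp [interleave]
    rw [this, pow_mul]
  have ho : ∀ k, (((interleave p (2 * k + 1) : Fin 2) : ℕ) : ℝ) / β ^ (2 * k + 1) =
      ((p.2 k : ℕ) : ℝ) / (β ^ 2) ^ k / β := by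
    intro k
    have : interleave p (2 * k + 1) = p.2 k := by
      simp only [interleave]
      rw [if_neg (by omega), show (2 * k + 1) / 2 = k by omega]
    rw [this, pow_succ, pow_mul, div_div]
  have hs := tsum_even_add_odd (f := fun n => (((interleave p n : Fin 2) : ℕ) : ℝ) / β ^ n)
    ((summable_piBeta hβ2 p.1).congr fun k => (he k).symm)
    (((summable_piBeta hβ2 p.2).div_const β).congr fun k => (ho k).symm)
  rw [piBeta, ← hs]
  simp only [he, ho]
  rw [tsum_div_const, piBeta, piBeta, mul_div_assoc, ← mul_add, ← mul_assoc, div_mul_cancel₀ _ h0]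

theorem measurePreserving_shift : MeasurePreserving shift coin coin :=
  ⟨measurable_shift, map_shift_coin⟩

theorem iterate_shift_apply (j : ℕ) (x : ℕ → Fin 2) (i : ℕ) : shift^[j] x i = x (i + j) := by
  induction j generalizing x i with
  | zero => rfl
  | succ j ih => rw [Function.iterate_succ_apply, ih]; rfl

theorem indepFun_iterate_shift {k : ℕ} {f : (ℕ → Fin 2) → ℝ}
    (hdep : ∀ x y : ℕ → Fin 2, (∀ i < k, x i = y i) → f x = f y) {a b : ℕ} (hab : a + k ≤ b) :
    ProbabilityTheory.IndepFun (fun x => f (shift^[a] x)) (fun x => f (shift^[b] x)) coin := by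
  let g : (c : ℕ) → ((Finset.Ico c (c + k) : Finset ℕ) → Fin 2) → ℝ := fun c w =>
    f fun i => if h : i + c ∈ Finset.Ico c (c + k) then w ⟨i + c, h⟩ else 0
  have hg : ∀ c x, f (shift^[c] x) = g c (fun i => x i) := by
    intro c x
    refine hdep _ _ fun i hi => ?_
    rw [iterate_shift_apply, dif_pos (by simp; omega)]
  have hind := (ProbabilityTheory.iIndepFun_infinitePi (P := fun _ : ℕ => fairBit)
    (X := fun _ ω => ω) (fun _ => measurable_id)).indepFun_finset
    (Finset.Ico a (a + k)) (Finset.Ico b (b + k))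
    (Finset.disjoint_left.2 fun i hi hj => by simp at hi hj; omega)
    (fun i => measurable_pi_apply i)
  simp only [hg]
  exact hind.comp (φ := g a) (ψ := g b) (measurable_of_finite _) (measurable_of_finite _)

/-- Law of large numbers for the shift, for functions of finitely many digits. -/
theorem ae_eventually_birkhoffSum_le {k : ℕ} (hk : 0 < k) {f : (ℕ → Fin 2) → ℝ}
    (hf : Measurable f) (hint : Integrable f coin) (h0 : ∀ x, 0 ≤ f x)
    (hdep : ∀ x y : ℕ → Fin 2, (∀ i < k, x i = y i) → f x = f y) {c : ℝ}
    (hc : ∫ x, f x ∂coin < c) :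
    ∀ᵐ x ∂coin, ∀ᶠ n : ℕ in atTop, ∑ j ∈ Finset.range n, f (shift^[j] x) ≤ n * c := by
  have hmp : ∀ j, MeasurePreserving shift^[j] coin coin := measurePreserving_shift.iterate
  have hlaw : ∀ r, ∀ᵐ x ∂coin, Tendsto (fun n : ℕ =>
      (∑ i ∈ Finset.range n, f (shift^[i * k + r] x)) / n) atTop (𝓝 (∫ x, f x ∂coin)) := by
    intro r
    have h := ProbabilityTheory.strong_law_ae_real (μ := coin)
      (fun i x => f (shift^[i * k + r] x)) ((hmp _).integrable_comp_of_integrable hint) ?_ ?_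
    · have he : ∫ x, f (shift^[0 * k + r] x) ∂coin = ∫ x, f x ∂coin := by
        have := integral_map (μ := coin) (hmp (0 * k + r)).measurable.aemeasurable
          (f := f) (by rw [(hmp _).map_eq]; exact hint.aestronglyMeasurable)
        rw [(hmp _).map_eq] at this
        exact this.symm
      rw [← he]
      exact h
    · intro i j hij
      rcases lt_or_gt_of_ne hij with h | h
      · exact indepFun_iterate_shift hdep (by nlinarith)
      · exact (indepFun_iterate_shift hdep (by nlinarith)).symm
    · intro i
      refine ⟨(hf.comp (hmp _).measurable).aemeasurable, (hf.comp (hmp _).measurable).aemeasurable,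
        ?_⟩
      have : ∀ j, coin.map (fun x => f (shift^[j] x)) = coin.map f := fun j => by
        have h := Measure.map_map (μ := coin) hf (hmp j).measurable
        rw [(hmp j).map_eq] at h
        exact h.symm
      rw [this, this]
  have hall := ae_all_iff.2 hlaw
  obtain ⟨c', hc1, hc2⟩ := exists_between hc
  filter_upwards [hall] with x hx
  have h1 : ∀ᶠ N : ℕ in atTop, ∀ r ∈ Finset.range k,
      ∑ i ∈ Finset.range N, f (shift^[i * k + r] x) ≤ N * c' := by
    refine (Finset.eventually_all (Finset.range k)).2 fun r _ => ?_
    filter_upwards [(hx r).eventually (gt_mem_nhds hc1), eventually_gt_atTop 0] with N hN hN0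
    have hN0' : (0 : ℝ) < N := by exact_mod_cast hN0
    rw [div_lt_iff₀ hN0'] at hN
    linarith
  have h2 : ∀ᶠ N : ℕ in atTop, ∑ j ∈ Finset.range (N * k), f (shift^[j] x) ≤ (N * k : ℕ) * c' := by
    filter_upwards [h1] with N hN
    have hs : ∑ j ∈ Finset.range (N * k), f (shift^[j] x) =
        ∑ r ∈ Finset.range k, ∑ i ∈ Finset.range N, f (shift^[i * k + r] x) := by
      clear hN
      rw [Finset.sum_comm]
      induction N with
      | zero => simp
      | succ N ih =>
        rw [Finset.sum_range_succ, ← ih, add_mul, one_mul, Finset.sum_range_add]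
    rw [hs]
    calc _ ≤ ∑ r ∈ Finset.range k, (N * c' : ℝ) := Finset.sum_le_sum hN
      _ = _ := by simp; ring
  have h3 : Tendsto (fun n : ℕ => n / k + 1) atTop atTop :=
    tendsto_atTop_mono (fun n => Nat.le_succ _) (Nat.tendsto_div_const_atTop hk.ne')
  have hc'0 : 0 ≤ c' := (integral_nonneg h0).trans hc1.le
  have h4 : ∀ᶠ n : ℕ in atTop, (k : ℝ) * c' / (c - c') ≤ n :=
    tendsto_natCast_atTop_atTop.eventually_ge_atTop _
  filter_upwards [h3.eventually h2, h4] with n hn hn'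
  have hle : n ≤ (n / k + 1) * k := by
    have := Nat.div_add_mod n k; have := Nat.mod_lt n hk; nlinarith
  have hle2 : (n / k + 1) * k ≤ n + k := by
    have := Nat.div_mul_le_self n k; nlinarith
  calc _ ≤ ∑ j ∈ Finset.range ((n / k + 1) * k), f (shift^[j] x) :=
        Finset.sum_le_sum_of_subset_of_nonneg (Finset.range_mono hle) fun _ _ _ => h0 _
    _ ≤ _ := hn
    _ ≤ ((n + k : ℕ) : ℝ) * c' := by gcongr
    _ ≤ n * c := by
      rw [div_le_iff₀ (by linarith)] at hn'
      push_cast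
      linarith

/-- Up to arbitrarily small mass, `ρ` is Frostman-regular with every exponent below `c`. -/
def IsFrostman (ρ : Measure ℝ) (c : ℝ) : Prop :=
  ∀ s, 0 ≤ s → s < c → ∀ δ : ℝ≥0∞, δ ≠ 0 → ∃ ρ' ≤ ρ, ρ Set.univ ≤ ρ' Set.univ + δ ∧
    ∃ C : ℝ≥0∞, C ≠ ∞ ∧ ∀ x r, 0 < r → ρ' (Metric.closedBall x r) ≤ C * ENNReal.ofReal (r ^ s)

/-- The total potential collected along the expansion `ε` by the point `x`. -/
noncomputable def pathCost (β : ℝ) (V : ℝ → ℝ) : ℕ → (ℕ → Fin 2) → ℝ → ℝ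
  | 0, _, _ => 0
  | n + 1, ε, x =>
    if ε 0 = 1 then V (β * x - β + 1) + pathCost β V n (shift ε) (β * x - β + 1)
    else V (1 - β * x) + pathCost β V n (shift ε) (β * x)

theorem measurable_pathCost (β : ℝ) (V : ℝ → ℝ) (n : ℕ) (x : ℝ) :
    Measurable fun ε => pathCost β V n ε x := by
  induction n generalizing x with
  | zero => exact measurable_const
  | succ n ih =>
    simp only [pathCost]
    refine Measurable.ite ?_ (((ih _).comp measurable_shift).const_add _)
      (((ih _).comp measurable_shift).const_add _)
    exact measurable_pi_apply (X := fun _ => Fin 2) 0 (measurableSet_singleton 1)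

theorem lintegral_exp_neg_pathCost_le {β : ℝ} {V : ℝ → ℝ}
    (hsep : ∀ y, Real.exp (-V y) + Real.exp (-V (2 - β - y)) ≤ 1) (n : ℕ) (x : ℝ) :
    ∫⁻ ε, ENNReal.ofReal (Real.exp (-pathCost β V n ε x)) ∂coin ≤ 2⁻¹ ^ n := by
  have hm : ∀ n x, Measurable fun ε => ENNReal.ofReal (Real.exp (-pathCost β V n ε x)) :=
    fun n x => (Real.measurable_exp.comp (measurable_pathCost β V n x).neg).ennreal_ofReal
  induction n generalizing x with
  | zero => simp [pathCost]
  | succ n ih =>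
    rw [lintegral_coin (hm _ _)]
    have e0 : ∀ ε, pathCost β V (n + 1) (consDigit 0 ε) x =
        V (1 - β * x) + pathCost β V n ε (β * x) := fun ε => if_neg Fin.zero_ne_one
    have e1 : ∀ ε, pathCost β V (n + 1) (consDigit 1 ε) x =
        V (β * x - β + 1) + pathCost β V n ε (β * x - β + 1) := fun ε => if_pos rfl
    simp only [e0, e1, neg_add, Real.exp_add, ENNReal.ofReal_mul (Real.exp_nonneg _)]
    rw [lintegral_const_mul _ (hm _ _), lintegral_const_mul _ (hm _ _)]
    have h := hsep (1 - β * x)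
    rw [show 2 - β - (1 - β * x) = β * x - β + 1 by ring] at h
    calc _ ≤ 2⁻¹ * (ENNReal.ofReal (Real.exp (-V (1 - β * x))) * 2⁻¹ ^ n) +
          2⁻¹ * (ENNReal.ofReal (Real.exp (-V (β * x - β + 1))) * 2⁻¹ ^ n) := by
          gcongr <;> exact ih _
      _ = (ENNReal.ofReal (Real.exp (-V (1 - β * x)) + Real.exp (-V (β * x - β + 1)))) *
          2⁻¹ ^ (n + 1) := by
          rw [ENNReal.ofReal_add (Real.exp_nonneg _) (Real.exp_nonneg _), pow_succ]
          ring
      _ ≤ 1 * 2⁻¹ ^ (n + 1) := by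
          gcongr
          exact ENNReal.ofReal_le_one.2 h
      _ = _ := one_mul _

/-- The potential seen from the coded point, with a safety margin `κ`; here `p` plays the role
of the coding map. -/
noncomputable def digitPotential (V : ℝ → ℝ) (p : (ℕ → Fin 2) → ℝ) (κ : ℝ) (ε : ℕ → Fin 2) : ℝ :=
  if ε 0 = 1 then V (p (shift ε) - κ) else V (1 - p (shift ε) - κ)

theorem pathCost_le {β : ℝ} (hβ : 1 < β) {V : ℝ → ℝ} (hV : Antitone V) {κ : ℝ} (n : ℕ)
    (ε : ℕ → Fin 2) (x : ℝ) (h : |x - piBeta β ε| * β ^ n ≤ κ) :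
    pathCost β V n ε x ≤
      ∑ j ∈ Finset.range n, digitPotential V (piBeta β) κ (shift^[j] ε) := by
  have hb : (0 : ℝ) < β := by linarith
  induction n generalizing ε x with
  | zero => simp [pathCost]
  | succ n ih =>
    rw [Finset.sum_range_succ']
    simp only [Function.iterate_succ_apply, Function.iterate_zero_apply]
    have hs := piBeta_shift hβ ε
    have key : ∀ z, z - piBeta β (shift ε) = β * (x - piBeta β ε) →
        |z - piBeta β (shift ε)| * β ^ n ≤ κ ∧ |z - piBeta β (shift ε)| ≤ κ := by
      intro z hz
      have h1 : |z - piBeta β (shift ε)| * β ^ n ≤ κ := by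
        rw [hz, abs_mul, abs_of_pos hb]
        calc _ = |x - piBeta β ε| * β ^ (n + 1) := by ring
          _ ≤ κ := h
      exact ⟨h1, (le_mul_of_one_le_right (abs_nonneg _) (one_le_pow₀ hβ.le)).trans h1⟩
    by_cases h1 : ε 0 = 1
    · rw [h1] at hs
      obtain ⟨k1, k2⟩ := key (β * x - β + 1) (by
        rw [hs]; simp only [Fin.val_one, Nat.cast_one]; field_simp; ring)
      have := ih _ _ k1
      have hv : V (β * x - β + 1) ≤ V (piBeta β (shift ε) - κ) := hV (by
        have := (abs_le.1 k2).1; linarith)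
      simp only [pathCost, digitPotential, if_pos h1] at this ⊢
      linarith
    · have h0 : ε 0 = 0 := by omega
      rw [h0] at hs
      obtain ⟨k1, k2⟩ := key (β * x) (by
        rw [hs]; simp only [Fin.val_zero, Nat.cast_zero]; field_simp; ring)
      have := ih _ _ k1
      have hv : V (1 - β * x) ≤ V (1 - piBeta β (shift ε) - κ) := hV (by
        have := (abs_le.1 k2).2; linarith)
      simp only [pathCost]
      rw [if_neg h1, digitPotential, if_neg h1]
      linarith

theorem measurable_digitPotential {V : ℝ → ℝ} (hV : Antitone V) {p : (ℕ → Fin 2) → ℝ}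
    (hp : Measurable p) (κ : ℝ) : Measurable (digitPotential V p κ) := by
  unfold digitPotential
  refine Measurable.ite (measurable_pi_apply (X := fun _ => Fin 2) 0 (measurableSet_singleton 1))
    ?_ ?_
  · exact hV.measurable.comp ((hp.comp measurable_shift).sub_const _)
  · exact hV.measurable.comp (((hp.comp measurable_shift).const_sub _).sub_const _)

theorem integrable_of_bounded {f : (ℕ → Fin 2) → ℝ} {M : ℝ} (hf : Measurable f)
    (h0 : ∀ x, 0 ≤ f x) (hM : ∀ x, f x ≤ M) : Integrable f coin :=
  Integrable.of_bound hf.aestronglyMeasurable M (ae_of_all _ fun x => by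
    rw [Real.norm_of_nonneg (h0 x)]; exact hM x)

theorem integral_digitPotential {β : ℝ} (hβ : 1 < β) {V : ℝ → ℝ} (hV : Antitone V)
    (h0 : ∀ x, 0 ≤ V x) (κ : ℝ) :
    ∫ ε, digitPotential V (piBeta β) κ ε ∂coin = ∫ x, V (x - κ) ∂(coin.map (piBeta β)) := by
  have hm := measurable_digitPotential hV (measurable_piBeta hβ) κ
  have h0' : ∀ ε, 0 ≤ digitPotential V (piBeta β) κ ε := by
    intro ε; unfold digitPotential; split_ifs <;> exact h0 _
  have hVm : Measurable fun x => V (x - κ) := hV.measurable.comp (measurable_id.sub_const κ)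
  rw [integral_map (measurable_piBeta hβ).aemeasurable hVm.aestronglyMeasurable,
    integral_eq_lintegral_of_nonneg_ae (ae_of_all _ h0') hm.aestronglyMeasurable,
    integral_eq_lintegral_of_nonneg_ae (ae_of_all _ fun _ => h0 _)
      (hVm.comp (measurable_piBeta hβ)).aestronglyMeasurable, lintegral_coin hm.ennreal_ofReal]
  congr 1
  have e0 : ∀ ε, digitPotential V (piBeta β) κ (consDigit 0 ε) = V (1 - piBeta β ε - κ) :=
    fun ε => if_neg Fin.zero_ne_one
  have e1 : ∀ ε, digitPotential V (piBeta β) κ (consDigit 1 ε) = V (piBeta β ε - κ) :=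
    fun ε => if_pos rfl
  simp only [e0, e1]
  have hflip : ∫⁻ ε, ENNReal.ofReal (V (1 - piBeta β ε - κ)) ∂coin =
      ∫⁻ ε, ENNReal.ofReal (V (piBeta β ε - κ)) ∂coin := by
    conv_rhs => rw [← map_flipDigits_coin]
    have hfm : Measurable fun ε => ENNReal.ofReal (V (piBeta β ε - κ)) :=
      (hVm.comp (measurable_piBeta hβ)).ennreal_ofReal
    rw [lintegral_map hfm measurable_flipDigits]
    simp only [piBeta_flipDigits hβ]
  rw [hflip, ← add_mul, ENNReal.inv_two_add_inv_two, one_mul]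

/-- Replace all digits from position `k` on by zero. -/
def truncDigits (k : ℕ) (x : ℕ → Fin 2) : ℕ → Fin 2 := fun i => if i < k then x i else 0

theorem measurable_truncDigits (k : ℕ) : Measurable (truncDigits k) := by
  refine measurable_pi_lambda _ fun i => ?_
  unfold truncDigits
  split_ifs
  · exact measurable_pi_apply i
  · exact measurable_const

theorem ae_eventually_sum_digitPotential_le {β : ℝ} (hβ : 1 < β) {V : ℝ → ℝ} (hV : Antitone V)
    {M : ℝ} (h0 : ∀ x, 0 ≤ V x) (hM : ∀ x, V x ≤ M) {κ : ℝ} (hκ : 0 < κ) {c : ℝ}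
    (hc : ∫ x, V (x - κ) ∂(coin.map (piBeta β)) < c) :
    ∀ᵐ ε ∂coin, ∀ᶠ n : ℕ in atTop,
      ∑ j ∈ Finset.range n, digitPotential V (piBeta β) (κ / 2) (shift^[j] ε) ≤ n * c := by
  obtain ⟨k, hk⟩ := exists_pow_lt_of_lt_one (show 0 < κ / 4 by positivity)
    (inv_lt_one_of_one_lt₀ hβ)
  have hclose : ∀ ε, |piBeta β ε - piBeta β (truncDigits k ε)| ≤ κ / 4 := fun ε =>
    (abs_piBeta_sub_le hβ k _ _ fun i hi => by simp [truncDigits, hi]).trans hk.le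
  set p := fun ε => piBeta β (truncDigits k ε)
  have hp : Measurable p := (measurable_piBeta hβ).comp (measurable_truncDigits k)
  set φ := digitPotential V p (3 * κ / 4)
  have hle1 : ∀ ε, digitPotential V (piBeta β) (κ / 2) ε ≤ φ ε := by
    intro ε
    have := abs_le.1 (hclose (shift ε))
    simp only [φ, digitPotential]
    split_ifs
    · exact hV (by linarith)
    · exact hV (by linarith)
  have hle2 : ∀ ε, φ ε ≤ digitPotential V (piBeta β) κ ε := by
    intro ε
    have := abs_le.1 (hclose (shift ε))
    simp only [φ, digitPotential]
    split_ifs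
    · exact hV (by linarith)
    · exact hV (by linarith)
  have hb : ∀ q κ ε, 0 ≤ digitPotential V q κ ε ∧ digitPotential V q κ ε ≤ M := by
    intro q κ ε; unfold digitPotential; split_ifs <;> exact ⟨h0 _, hM _⟩
  have hint : ∀ q κ, Measurable q → Integrable (digitPotential V q κ) coin := fun q κ hq =>
    integrable_of_bounded (measurable_digitPotential hV hq κ) (fun ε => (hb q κ ε).1)
      (fun ε => (hb q κ ε).2)
  have hmean : ∫ ε, φ ε ∂coin < c := by
    refine lt_of_le_of_lt ?_ hc
    rw [← integral_digitPotential hβ hV h0]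
    exact integral_mono (hint _ _ hp) (hint _ _ (measurable_piBeta hβ)) hle2
  have hdep : ∀ x y : ℕ → Fin 2, (∀ i < k + 1, x i = y i) → φ x = φ y := by
    intro x y hxy
    have : truncDigits k (shift x) = truncDigits k (shift y) := by
      funext i
      unfold truncDigits
      split_ifs with hi
      · exact hxy (i + 1) (by omega)
      · rfl
    simp only [φ, digitPotential, p, this, hxy 0 (by omega)]
  filter_upwards [ae_eventually_birkhoffSum_le k.succ_pos
    (measurable_digitPotential hV hp _) (hint _ _ hp) (fun ε => (hb _ _ ε).1) hdep hmean] with ε hε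
  filter_upwards [hε] with n hn
  exact (Finset.sum_le_sum fun j _ => hle1 _).trans hn

theorem isFrostman_of_potential {β : ℝ} (hβ : 1 < β) {V : ℝ → ℝ} (hV : Antitone V)
    {M : ℝ} (h0 : ∀ x, 0 ≤ V x) (hM : ∀ x, V x ≤ M)
    (hsep : ∀ y, Real.exp (-V y) + Real.exp (-V (2 - β - y)) ≤ 1) {κ : ℝ} (hκ : 0 < κ) {h : ℝ}
    (hh : ∫ x, V (x - κ) ∂(coin.map (piBeta β)) ≤ h) :
    IsFrostman (coin.map (piBeta β)) ((Real.log 2 - h) / Real.log β) := by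
  intro s hs0 hs δ hδ
  have hb : (0 : ℝ) < β := by linarith
  have hlog : 0 < Real.log β := Real.log_pos hβ
  rw [lt_div_iff₀ hlog] at hs
  set c := Real.log 2 - s * Real.log β with hc
  have hae := ae_eventually_sum_digitPotential_le hβ hV h0 hM hκ (c := c) (by linarith)
  set A : ℕ → Set (ℕ → Fin 2) := fun N => {ε | ∀ n ≥ N,
    ∑ j ∈ Finset.range n, digitPotential V (piBeta β) (κ / 2) (shift^[j] ε) ≤ n * c} with hA
  have hAm : ∀ N, MeasurableSet (A N) := by
    intro N
    have : A N = ⋂ n, ⋂ (_ : n ≥ N), {ε | ∑ j ∈ Finset.range n,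
        digitPotential V (piBeta β) (κ / 2) (shift^[j] ε) ≤ n * c} := by
      ext ε; simp [hA]
    rw [this]
    refine MeasurableSet.iInter fun n => MeasurableSet.iInter fun _ => ?_
    refine measurableSet_le (Finset.measurable_sum _ fun j _ => ?_) measurable_const
    exact (measurable_digitPotential hV (measurable_piBeta hβ) _).comp
      (measurePreserving_shift.iterate j).measurable
  have hAmono : Monotone A := fun a b hab ε hε n hn => hε n (hab.trans hn)
  have hAu : coin (⋃ N, A N) = 1 := by
    rw [← prob_compl_eq_zero_iff (MeasurableSet.iUnion hAm), ← nonpos_iff_eq_zero]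
    refine (measure_mono ?_).trans (le_of_eq hae)
    intro ε hε hε'
    obtain ⟨N, hN⟩ := eventually_atTop.1 hε'
    exact hε (Set.mem_iUnion.2 ⟨N, hN⟩)
  have hlim := tendsto_measure_iUnion_atTop (μ := coin) hAmono
  rw [hAu] at hlim
  have hδ1 : (1 : ℝ≥0∞) < 1 + δ := ENNReal.lt_add_right ENNReal.one_ne_top hδ
  obtain ⟨N, hN⟩ : ∃ N, 1 < coin (A N) + δ :=
    ((hlim.add_const δ).eventually (lt_mem_nhds hδ1)).exists
  have hπ := measurable_piBeta hβ
  have hball : ∀ n ≥ N, ∀ x, ((coin.restrict (A N)).map (piBeta β))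
      (Metric.closedBall x (κ / 2 * β⁻¹ ^ n)) ≤ ENNReal.ofReal ((β⁻¹ ^ n) ^ s) := by
    intro n hn x
    rw [Measure.map_apply hπ Metric.isClosed_closedBall.measurableSet,
      Measure.restrict_apply (hπ Metric.isClosed_closedBall.measurableSet)]
    have hsub : piBeta β ⁻¹' Metric.closedBall x (κ / 2 * β⁻¹ ^ n) ∩ A N ⊆
        {ε | ENNReal.ofReal (Real.exp (-(n * c))) ≤
          ENNReal.ofReal (Real.exp (-pathCost β V n ε x))} := by
      rintro ε ⟨h1, h2⟩
      have h1' : |x - piBeta β ε| ≤ κ / 2 * β⁻¹ ^ n := by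
        rw [abs_sub_comm]; exact h1
      have h3 : |x - piBeta β ε| * β ^ n ≤ κ / 2 := by
        rwa [inv_pow, ← div_eq_mul_inv, le_div_iff₀ (by positivity)] at h1'
      have h4 := (pathCost_le hβ hV n ε x h3).trans (h2 n hn)
      exact ENNReal.ofReal_le_ofReal (Real.exp_le_exp.2 (by linarith))
    have hmarkov := mul_meas_ge_le_lintegral (μ := coin)
      (f := fun ε => ENNReal.ofReal (Real.exp (-pathCost β V n ε x)))
      (Real.measurable_exp.comp (measurable_pathCost β V n x).neg).ennreal_ofReal
      (ENNReal.ofReal (Real.exp (-(n * c))))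
    have h5 := (mul_le_mul_right (measure_mono (μ := coin) hsub) _).trans
      (hmarkov.trans (lintegral_exp_neg_pathCost_le hsep n x))
    have hval : ENNReal.ofReal (Real.exp (-(n * c))) * ENNReal.ofReal ((β⁻¹ ^ n) ^ s) =
        2⁻¹ ^ n := by
      rw [← ENNReal.ofReal_mul (Real.exp_nonneg _)]
      have : (2⁻¹ : ℝ≥0∞) ^ n = ENNReal.ofReal (2⁻¹ ^ n) := by
        rw [ENNReal.ofReal_pow (by norm_num), ENNReal.ofReal_inv_of_pos (by norm_num)]; simp
      rw [this]
      congr 1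
      have e2 : (2⁻¹ : ℝ) ^ n = Real.exp (-(n * Real.log 2)) := by
        rw [Real.exp_neg, Real.exp_nat_mul, Real.exp_log (by norm_num), inv_pow]
      have eβ : (β⁻¹ ^ n) ^ s = Real.exp (-(n * (s * Real.log β))) := by
        rw [Real.rpow_def_of_pos (by positivity), Real.log_pow, Real.log_inv]
        congr 1; ring
      rw [e2, eβ, ← Real.exp_add]
      congr 1
      rw [hc]; ring
    rw [← hval] at h5
    exact (ENNReal.mul_le_mul_iff_right (by simpa using Real.exp_pos _) ENNReal.ofReal_ne_top).1 h5
  refine ⟨(coin.restrict (A N)).map (piBeta β),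
    Measure.map_mono Measure.restrict_le_self hπ, ?_,
    ENNReal.ofReal ((2 * β / κ * β ^ N) ^ s), ENNReal.ofReal_ne_top, ?_⟩
  · rw [Measure.map_apply hπ MeasurableSet.univ, Measure.map_apply hπ MeasurableSet.univ]
    simpa using hN.le
  · intro x r hr
    rw [← ENNReal.ofReal_mul (by positivity), ← Real.mul_rpow (by positivity) hr.le]
    have hβi : β⁻¹ < 1 := inv_lt_one_of_one_lt₀ hβ
    rcases le_or_gt (r / (κ / 2 * β⁻¹ ^ N)) 1 with h1 | h1
    · obtain ⟨n, hn1, hn2⟩ := exists_nat_pow_near_of_lt_one (by positivity) h1 (inv_pos.2 hb) hβi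
      rw [div_le_iff₀ (by positivity)] at hn2
      rw [lt_div_iff₀ (by positivity)] at hn1
      refine (measure_mono
        (Metric.closedBall_subset_closedBall (ε₂ := κ / 2 * β⁻¹ ^ (N + n)) ?_)).trans
        ((hball (N + n) (by omega) x).trans (ENNReal.ofReal_le_ofReal ?_))
      · calc r ≤ _ := hn2
          _ = _ := by ring
      · refine Real.rpow_le_rpow (by positivity) ?_ hs0
        have h2 : 1 ≤ β ^ N := one_le_pow₀ hβ.le
        have h3 : β⁻¹ ^ (N + n) ≤ 2 * β / κ * r := by
          have : β⁻¹ ^ (N + n) = 2 * β / κ * (β⁻¹ ^ (n + 1) * (κ / 2 * β⁻¹ ^ N)) := by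
            rw [pow_add, pow_succ]; field_simp
          rw [this]
          gcongr
        calc _ ≤ _ := h3
          _ ≤ 2 * β / κ * r * β ^ N := le_mul_of_one_le_right (by positivity) h2
          _ = _ := by ring
    · have hu : ((coin.restrict (A N)).map (piBeta β)) (Metric.closedBall x r) ≤ 1 := by
        rw [Measure.map_apply hπ Metric.isClosed_closedBall.measurableSet]
        exact (Measure.restrict_apply_le _ _).trans prob_le_one
      refine hu.trans ?_
      rw [← ENNReal.ofReal_one]
      refine ENNReal.ofReal_le_ofReal (Real.one_le_rpow ?_ hs0)
      have h2 : r / (κ / 2 * β⁻¹ ^ N) = 2 / κ * β ^ N * r := by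
        rw [inv_pow]; field_simp
      rw [h2] at h1
      calc (1 : ℝ) ≤ 2 / κ * β ^ N * r := h1.le
        _ ≤ 2 / κ * β ^ N * r * β := le_mul_of_one_le_right (by positivity) hβ.le
        _ = _ := by ring

theorem IsFrostman.ae_eventually_le {ρ : Measure ℝ} [IsFiniteMeasure ρ] {D s : ℝ}
    (hF : IsFrostman ρ D) (hs0 : 0 ≤ s) (hs : s < D) :
    ∀ᵐ x ∂ρ, ∃ K : ℝ≥0∞, K ≠ ∞ ∧
      ∀ᶠ r : ℝ in 𝓝[>] 0, ρ (Metric.closedBall x r) ≤ K * ENNReal.ofReal (r ^ s) := by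
  change ρ {x | ¬ _} = 0
  set B := {x | ¬ ∃ K : ℝ≥0∞, K ≠ ∞ ∧
      ∀ᶠ r : ℝ in 𝓝[>] 0, ρ (Metric.closedBall x r) ≤ K * ENNReal.ofReal (r ^ s)} with hB
  by_contra hne
  obtain ⟨δ, hδ0, hδ⟩ := exists_between (pos_iff_ne_zero.2 hne)
  refine absurd hδ (not_lt.2 ?_)
  obtain ⟨ρ', hle, hmass, C, hC, hball⟩ := hF s hs0 hs δ hδ0.ne'
  have : IsFiniteMeasure ρ' := ⟨(hle Set.univ).trans_lt (measure_lt_top ρ _)⟩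
  have hρ'B : ρ' B = 0 := by
    have h1 := Besicovitch.ae_tendsto_rnDeriv ρ ρ'
    have h2 := Measure.rnDeriv_lt_top ρ ρ'
    have : ∀ᵐ x ∂ρ', ∃ K : ℝ≥0∞, K ≠ ∞ ∧
      ∀ᶠ r : ℝ in 𝓝[>] 0, ρ (Metric.closedBall x r) ≤ K * ENNReal.ofReal (r ^ s) := by
      filter_upwards [h1, h2] with x hx1 hx2
      have hK : ρ.rnDeriv ρ' x < ρ.rnDeriv ρ' x + 1 :=
        ENNReal.lt_add_right hx2.ne one_ne_zero
      have hKt : ρ.rnDeriv ρ' x + 1 ≠ ∞ := ENNReal.add_ne_top.2 ⟨hx2.ne, ENNReal.one_ne_top⟩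
      refine ⟨(ρ.rnDeriv ρ' x + 1) * C, ENNReal.mul_ne_top hKt hC, ?_⟩
      filter_upwards [hx1.eventually (gt_mem_nhds hK), self_mem_nhdsWithin] with r hr hr0
      have := (ENNReal.div_le_iff_le_mul (.inr hKt) (.inl (measure_ne_top _ _))).1 hr.le
      rw [mul_assoc]
      exact this.trans (by gcongr; exact hball x r hr0)
    exact this
  have ht0 : ρ' (toMeasurable ρ' B) = 0 := by rw [measure_toMeasurable, hρ'B]
  have htm := measurableSet_toMeasurable ρ' B
  set t := toMeasurable ρ' B
  refine (measure_mono (subset_toMeasurable ρ' B)).trans ?_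
  have h1 : ρ t + ρ tᶜ ≤ δ + ρ tᶜ := by
    rw [measure_add_measure_compl htm]
    refine hmass.trans ?_
    rw [← measure_add_measure_compl htm, ht0, zero_add, add_comm]
    gcongr
  exact (ENNReal.add_le_add_iff_right (measure_ne_top _ _)).1 h1

theorem IsFrostman.ae_le_liminf {ρ : Measure ℝ} [IsFiniteMeasure ρ] {D b : ℝ}
    (hD : 0 < D) (hF : IsFrostman ρ D) (hb : 1 < b)
    (hlow : ∀ᵐ x ∂ρ, ∀ n : ℕ, 2⁻¹ ^ n ≤ ρ (Metric.closedBall x (b⁻¹ ^ n))) :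
    ∀ᵐ x ∂ρ, D ≤ liminf (fun r : ℝ =>
      Real.log (ρ (Metric.closedBall x r)).toReal / Real.log r) (𝓝[>] 0) := by
  have hb0 : 0 < b := by linarith
  have hbi : b⁻¹ < 1 := inv_lt_one_of_one_lt₀ hb
  have hall : ∀ᵐ x ∂ρ, ∀ k : ℕ, ∃ K : ℝ≥0∞, K ≠ ∞ ∧ ∀ᶠ r : ℝ in 𝓝[>] 0,
      ρ (Metric.closedBall x r) ≤ K * ENNReal.ofReal (r ^ (D - D / (k + 1))) := by
    refine ae_all_iff.2 fun k => hF.ae_eventually_le ?_ ?_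
    · have : D / (k + 1) ≤ D := div_le_self hD.le (by linarith [Nat.cast_nonneg (α := ℝ) k])
      linarith
    · have : 0 < D / (k + 1) := by positivity
      linarith
  filter_upwards [hall, hlow] with x hx hx'
  have hpos : ∀ r, 0 < r → 0 < (ρ (Metric.closedBall x r)).toReal := by
    intro r hr
    obtain ⟨n, hn⟩ := exists_pow_lt_of_lt_one hr hbi
    refine ENNReal.toReal_pos (fun h => ?_) (measure_ne_top _ _)
    have h1 := (hx' n).trans (measure_mono (Metric.closedBall_subset_closedBall hn.le))
    rw [h, nonpos_iff_eq_zero] at h1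
    exact pow_ne_zero n (by simp) h1
  have hr1 : ∀ᶠ r : ℝ in 𝓝[>] 0, r < 1 := by
    filter_upwards [Ioo_mem_nhdsGT (show (0 : ℝ) < 1 by norm_num)] with r hr using hr.2
  have hcob : (𝓝[>] (0 : ℝ)).IsCoboundedUnder (· ≥ ·) (fun r : ℝ =>
      Real.log (ρ (Metric.closedBall x r)).toReal / Real.log r) := by
    have hfreq : ∃ᶠ r in 𝓝[>] (0 : ℝ),
        Real.log (ρ (Metric.closedBall x r)).toReal / Real.log r ≤ Real.log 2 / Real.log b := by
      have ht : Tendsto (fun n : ℕ => b⁻¹ ^ (n + 1)) atTop (𝓝[>] 0) := by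
        refine tendsto_nhdsWithin_iff.2 ⟨?_, Eventually.of_forall fun n => ?_⟩
        · exact (tendsto_pow_atTop_nhds_zero_of_lt_one (by positivity) hbi).comp
            (tendsto_add_atTop_nat 1)
        · exact pow_pos (inv_pos.2 hb0) _
      refine ht.frequently (Eventually.frequently (Eventually.of_forall fun n => ?_))
      have h1 : (2⁻¹ : ℝ) ^ (n + 1) ≤ (ρ (Metric.closedBall x (b⁻¹ ^ (n + 1)))).toReal := by
        have := ENNReal.toReal_mono (measure_ne_top _ _) (hx' (n + 1))
        simpa using this
      have h2 := Real.log_le_log (by positivity) h1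
      rw [Real.log_pow, Real.log_inv] at h2
      have hlb := Real.log_pos hb
      rw [Real.log_pow, Real.log_inv, div_le_iff_of_neg (by
        have : 0 < ((n + 1 : ℕ) : ℝ) * Real.log b := by positivity
        linarith)]
      have h3 : Real.log 2 / Real.log b * (((n + 1 : ℕ) : ℝ) * -Real.log b) =
          ((n + 1 : ℕ) : ℝ) * -Real.log 2 := by field_simp
      rw [h3]
      exact h2
    exact IsCoboundedUnder.of_frequently_le hfreq
  refine le_of_forall_lt fun c hc => ?_
  obtain ⟨c', hc1, hc2⟩ := exists_between hc
  refine hc1.trans_le (le_liminf_of_le hcob ?_)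
  have ht : Tendsto (fun k : ℕ => D - D / (k + 1)) atTop (𝓝 (D - 0)) :=
    by
    refine tendsto_const_nhds.sub (Tendsto.const_div_atTop ?_ D)
    exact tendsto_atTop_add_const_right _ _ tendsto_natCast_atTop_atTop
  rw [sub_zero] at ht
  obtain ⟨k, hk⟩ := (ht.eventually (lt_mem_nhds hc2)).exists
  obtain ⟨K, hK, hev⟩ := hx k
  set s := D - D / (k + 1)
  have hKlim : Tendsto (fun r : ℝ => s + Real.log (K.toReal + 1) / Real.log r) (𝓝[>] 0)
      (𝓝 (s + 0)) :=
    tendsto_const_nhds.add (tendsto_const_nhds.div_atBot Real.tendsto_log_nhdsGT_zero)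
  rw [add_zero] at hKlim
  filter_upwards [hKlim.eventually (lt_mem_nhds hk), hev, hr1, self_mem_nhdsWithin]
    with r h1 h2 h3 h4
  have h4' : (0 : ℝ) < r := h4
  refine h1.le.trans ?_
  have hlr : Real.log r < 0 := Real.log_neg h4' h3
  have h5 : (ρ (Metric.closedBall x r)).toReal ≤ (K.toReal + 1) * r ^ s := by
    have := ENNReal.toReal_mono (ENNReal.mul_ne_top hK ENNReal.ofReal_ne_top) h2
    rw [ENNReal.toReal_mul, ENNReal.toReal_ofReal (by positivity)] at this
    refine this.trans ?_
    gcongr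
    linarith
  have h6 := Real.log_le_log (hpos r h4') h5
  have hK1 : 0 < K.toReal + 1 := by positivity
  rw [Real.log_mul hK1.ne' (by positivity), Real.log_rpow h4'] at h6
  rw [le_div_iff_of_neg hlr, add_mul, div_mul_cancel₀ _ hlr.ne]
  linarith

theorem ae_pow_le_measure_closedBall {β : ℝ} (hβ : 1 < β) :
    ∀ᵐ x ∂(coin.map (piBeta β)), ∀ n : ℕ,
      2⁻¹ ^ n ≤ coin.map (piBeta β) (Metric.closedBall x (β⁻¹ ^ n)) := by
  have hc := continuous_piBeta hβ
  filter_upwards [ae_map_mem_range (piBeta β) (isCompact_range hc).isClosed.measurableSet coin]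
  rintro _ ⟨ε, rfl⟩ n
  rw [Measure.map_apply hc.measurable Metric.isClosed_closedBall.measurableSet,
    ← isCoinMeasure_coin.2 n (fun j => ε j)]
  refine measure_mono fun ε' hε' => ?_
  exact abs_piBeta_sub_le hβ n _ _ fun i hi => hε' ⟨i, hi⟩

theorem IsFrostman.map_mul_add_prod {ρ : Measure ℝ} [IsProbabilityMeasure ρ] {D : ℝ}
    (hF : IsFrostman ρ D) (ν : Measure ℝ) [IsProbabilityMeasure ν] {a : ℝ} (ha : 0 < a) :
    IsFrostman ((ρ.prod ν).map fun p => a * p.1 + p.2) D := by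
  have hm : Measurable fun p : ℝ × ℝ => a * p.1 + p.2 := by fun_prop
  intro s hs0 hs δ hδ
  obtain ⟨ρ', hle, hmass, C, hC, hball⟩ := hF s hs0 hs δ hδ
  have : IsFiniteMeasure ρ' := ⟨(hle Set.univ).trans_lt (measure_lt_top ρ _)⟩
  refine ⟨(ρ'.prod ν).map fun p => a * p.1 + p.2, ?_, ?_, C * ENNReal.ofReal (a⁻¹ ^ s),
    ENNReal.mul_ne_top hC ENNReal.ofReal_ne_top, ?_⟩
  · refine Measure.map_mono ?_ hm
    exact Measure.prod_mono hle le_rfl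
  · rw [Measure.map_apply hm MeasurableSet.univ, Measure.map_apply hm MeasurableSet.univ]
    simpa [← Set.univ_prod_univ, Measure.prod_prod] using hmass
  · intro x r hr
    have hmb : MeasurableSet ((fun p : ℝ × ℝ => a * p.1 + p.2) ⁻¹' Metric.closedBall x r) :=
      hm Metric.isClosed_closedBall.measurableSet
    rw [Measure.map_apply hm Metric.isClosed_closedBall.measurableSet,
      Measure.prod_apply_symm hmb]
    calc _ ≤ ∫⁻ _, C * ENNReal.ofReal ((a⁻¹ * r) ^ s) ∂ν := by
          refine lintegral_mono fun y => ?_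
          refine (measure_mono (t := Metric.closedBall (a⁻¹ * (x - y)) (a⁻¹ * r)) ?_).trans
            (hball _ _ (by positivity))
          intro z hz
          have hz' : |a * z + y - x| ≤ r := hz
          change |z - a⁻¹ * (x - y)| ≤ a⁻¹ * r
          have : z - a⁻¹ * (x - y) = a⁻¹ * (a * z + y - x) := by field_simp; ring
          rw [this, abs_mul, abs_of_pos (inv_pos.2 ha)]
          gcongr
      _ = _ := by
          rw [lintegral_const, measure_univ, mul_one, Real.mul_rpow (by positivity) hr.le,
            ENNReal.ofReal_mul (by positivity), mul_assoc]

theorem isFrostman_piBeta_of_sq {β D : ℝ} (hβ : 1 < β)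
    (hF : IsFrostman (coin.map (piBeta (β ^ 2))) D) : IsFrostman (coin.map (piBeta β)) D := by
  have hb : (0 : ℝ) < β := by linarith
  have hβ2 : 1 < β ^ 2 := by nlinarith
  set a := (1 - 1 / β) / (1 - 1 / β ^ 2) with ha
  have ha0 : 0 < a := div_pos (one_sub_one_div_pos hβ) (one_sub_one_div_pos hβ2)
  have hm := measurable_piBeta hβ2
  have hm' : Measurable fun x => a * (piBeta (β ^ 2) x / β) := (hm.div_const _).const_mul _
  have h1 := Measure.isProbabilityMeasure_map (μ := coin) hm.aemeasurable
  have h2 := Measure.isProbabilityMeasure_map (μ := coin) hm'.aemeasurable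
  have h3 := hF.map_mul_add_prod (coin.map fun x => a * (piBeta (β ^ 2) x / β)) ha0
  convert h3 using 1
  rw [Measure.map_prod_map _ _ hm hm', Measure.map_map (by fun_prop) (by fun_prop)]
  conv_lhs => rw [← map_interleave_coin]
  rw [Measure.map_map (measurable_piBeta hβ) measurable_interleave]
  congr 1
  funext p
  simp only [Function.comp_apply, piBeta_interleave hβ, Prod.map_fst, Prod.map_snd]
  rw [← ha]; ring

/-- Evaluate `x` to a literal before passing it to `f`; propositionally this is `f x`. -/
def natSeq {α : Type} (x : ℕ) (f : ℕ → α) : α :=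
  Nat.rec (f 0) (fun n _ => f (Nat.succ n)) x

/-- The fixed-point unit used for parameters, positions and probabilities. -/
def fpUnit : ℕ := 1000000000000

/-- The fixed-point unit used for values of the exponential function. -/
def expUnit : ℕ := 1000000000000000000

/-- `2 ^ d * fpUnit` times an upper bound of the distribution function of the Bernoulli
convolution at `hi / fpUnit`, obtained by `d` applications of the self-similarity relation. -/
def cdfSum (b₁ b₂ : ℕ) (leaf : ℕ → ℕ) (d : ℕ) : ℕ → ℕ :=
  Nat.rec leaf
    (fun d ih hi => bif Nat.ble fpUnit hi then Nat.mul fpUnit (Nat.pow 2 (Nat.succ d)) else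
      Nat.add (natSeq (Nat.succ (Nat.div (Nat.mul b₂ hi) fpUnit)) ih)
       (natSeq (Nat.div (Nat.mul b₁ (Nat.sub fpUnit hi)) fpUnit)
        (fun u => bif Nat.ble u fpUnit then natSeq (Nat.sub fpUnit u) ih else 0))) d

/-- Upper bound of the distribution function from `d` steps of self-similarity. -/
def cdfUpper (b₁ b₂ : ℕ) (leaf : ℕ → ℕ) (d hi : ℕ) : ℕ :=
  Nat.succ (Nat.div (cdfSum b₁ b₂ leaf d hi) (Nat.pow 2 d))

/-- The base used to store tables in a single natural number. -/
def tableBase : ℕ := 1000000000001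

/-- Store `min (f ((j + 1) / n)) 1` for `j < k` as the digits of a natural number. -/
def tableEncode (f : ℕ → ℕ) (n k : ℕ) : ℕ :=
  Nat.rec 0 (fun j ih => Nat.add (Nat.mul (Nat.pow tableBase j)
    (natSeq (Nat.succ (Nat.div (Nat.mul (Nat.succ j) fpUnit) n))
      (fun x => natSeq (f x) (fun y => bif Nat.ble y fpUnit then y else fpUnit)))) ih) k

/-- Read a table produced by `tableEncode`. -/
def tableDecode (n T hi : ℕ) : ℕ :=
  bif Nat.ble fpUnit hi then fpUnit else
    Nat.mod (Nat.div T (Nat.pow tableBase (Nat.div (Nat.mul hi n) fpUnit))) tableBase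

/-- Evaluate a test on the result of iterated tabulation of upper bounds for the distribution
function. -/
def withStages (b₁ b₂ : ℕ) (k : (ℕ → ℕ) → Bool) (l : List (ℕ × ℕ)) : (ℕ → ℕ) → Bool :=
  List.rec (fun leaf => k leaf)
    (fun p _ ih leaf => bif Nat.ble 1 p.1 then
      natSeq (tableEncode (cdfUpper b₁ b₂ leaf p.2) p.1 p.1) (fun T => ih (tableDecode p.1 T))
      else false) l

/-- Upper bound for `exp (-(a / c))` in units of `expUnit`. -/
def expUpper (a c : ℕ) : ℕ :=
  Nat.rec (Nat.add (Nat.sub expUnit (Nat.div (Nat.mul expUnit a) (Nat.mul c 65536)))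
      (Nat.succ (Nat.div (Nat.mul expUnit (Nat.mul a a)) (Nat.mul 2
        (Nat.mul (Nat.mul c 65536) (Nat.mul c 65536))))))
    (fun _ ih => natSeq ih (fun x => Nat.succ (Nat.div (Nat.mul x x) expUnit))) 16

/-- Total weight of the entries whose first coordinate satisfies `p`, plus `m`. -/
def weightWhere (p : ℕ → Bool) (m : ℕ) (l : List (ℕ × ℕ)) : ℕ :=
  List.rec m (fun e _ ih => bif p e.1 then Nat.add e.2 ih else ih) l

/-- The separation condition `exp (-V y) + exp (-V (L - y)) ≤ 1` at one breakpoint. -/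
def sepCheckAt (den W m : ℕ) (l : List (ℕ × ℕ)) (s : ℕ) : Bool :=
  natSeq (weightWhere (fun t => Nat.ble (Nat.succ s) t) m l) fun A =>
  natSeq (weightWhere (fun t => Nat.ble den (Nat.add s t)) m l) fun B =>
  Nat.ble (Nat.add (expUpper A W) (expUpper B W)) expUnit

/-- The separation condition at every breakpoint of `l'`, and at infinity. -/
def sepCheck (den W m : ℕ) (l l' : List (ℕ × ℕ)) : Bool :=
  List.rec
    (natSeq (weightWhere (fun _ => true) m l) fun A =>
      Nat.ble (Nat.add (expUpper A W) (expUpper m W)) expUnit)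
    (fun e _ ih => bif sepCheckAt den W m l e.1 then ih else false) l'

/-- Upper bound for the integral of the step function, in units of `1 / (W * fpUnit)`. -/
def integralUpper (f : ℕ → ℕ → ℕ) (b₁ den m : ℕ) (l : List (ℕ × ℕ)) : ℕ :=
  List.rec (Nat.mul m fpUnit) (fun e _ ih =>
    Nat.add (Nat.mul e.2
      (natSeq (Nat.add 2 (Nat.div (Nat.mul (Nat.sub (Nat.mul 2 fpUnit) b₁) e.1) den))
        (f e.1))) ih) l

/-- A certificate for the dimension bound on an interval of parameters ending at `b / fpUnit`. -/
structure DimCert where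
  b : ℕ
  logB : ℕ
  stages : List (ℕ × ℕ)
  depth : ℕ
  den : ℕ
  W : ℕ
  m : ℕ
  steps : List (ℕ × ℕ)

/-- Check a certificate for parameters in `[b₁, c.b]`. -/
def DimCert.check (c : DimCert) (b₁ : ℕ) : Bool :=
  bif Nat.ble 1 c.den then bif Nat.ble 1 c.W then
  bif Nat.ble (Nat.mul (expUpper c.logB fpUnit) c.b) (Nat.mul expUnit fpUnit) then
  bif sepCheck c.den c.W c.m c.steps c.steps then
  withStages b₁ c.b (fun leaf => Nat.ble
    (Nat.add (Nat.mul 100000000000000000000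
      (integralUpper (fun s => cdfUpper b₁ c.b leaf
        (bif Nat.ble 1 s then c.depth else Nat.add 30 c.depth)) b₁ c.den c.m c.steps))
      (Nat.mul (Nat.mul 98040856 c.logB) (Nat.mul c.W fpUnit)))
    (Nat.mul 69314718030000000000 (Nat.mul c.W fpUnit))) c.stages (fun _ => fpUnit)
  else false else false else false else false

/-- Check a chain of certificates covering `[b₁, b₂]`. -/
def checkChain (b₂ : ℕ) (l : List DimCert) : ℕ → Bool :=
  List.rec (fun b₁ => Nat.ble b₂ b₁)
    (fun c _ ih b₁ => bif c.check b₁ then ih c.b else false) l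

theorem natSeq_eq {α : Type} (x : ℕ) (f : ℕ → α) : natSeq x f = f x := by
  cases x <;> rfl

theorem cast_div_lt_add_one (a : ℕ) {n : ℕ} (hn : 0 < n) : (a : ℝ) / n < ((a / n : ℕ) : ℝ) + 1 := by
  rw [div_lt_iff₀ (by exact_mod_cast hn), mul_comm]
  exact_mod_cast Nat.lt_mul_div_succ a hn

theorem fpUnit_pos : 0 < fpUnit := by norm_num [fpUnit]

theorem expUnit_pos : 0 < expUnit := by norm_num [expUnit]

theorem exp_neg_le_quadratic {y : ℝ} (hy : 0 ≤ y) : Real.exp (-y) ≤ 1 - y + y ^ 2 / 2 := by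
  have h := Real.quadratic_le_exp_of_nonneg hy
  rw [Real.exp_neg, inv_le_iff_one_le_mul₀ (Real.exp_pos _)]
  have h1 : 0 ≤ 1 - y + y ^ 2 / 2 := by nlinarith [sq_nonneg (y - 1)]
  nlinarith [mul_le_mul_of_nonneg_left h h1, sq_nonneg (y ^ 2)]

theorem exp_neg_le_expUpper (a : ℕ) {c : ℕ} (hc : 0 < c) :
    Real.exp (-(a / c : ℝ)) ≤ expUpper a c / expUnit := by
  have hE : (0 : ℝ) < expUnit := by exact_mod_cast expUnit_pos
  have hc' : (0 : ℝ) < c := by exact_mod_cast hc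
  set y : ℝ := a / (c * 65536) with hy
  have hy0 : 0 ≤ y := by positivity
  have key : ∀ n : ℕ, Real.exp (-y) ^ (2 ^ n) ≤
      ((Nat.rec (Nat.add (Nat.sub expUnit (Nat.div (Nat.mul expUnit a) (Nat.mul c 65536)))
      (Nat.succ (Nat.div (Nat.mul expUnit (Nat.mul a a)) (Nat.mul 2
        (Nat.mul (Nat.mul c 65536) (Nat.mul c 65536))))))
    (fun _ ih => natSeq ih (fun x => Nat.succ (Nat.div (Nat.mul x x) expUnit))) n : ℕ) : ℝ) /
      expUnit := by
    intro n
    induction n with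
    | zero =>
      rw [le_div_iff₀ hE, pow_zero, pow_one]
      have h1 : (expUnit : ℝ) - (expUnit * a / (c * 65536) : ℝ) ≤
          ((expUnit - expUnit * a / (c * 65536) : ℕ) : ℝ) := by
        have := Nat.cast_div_le (α := ℝ) (m := expUnit * a) (n := c * 65536)
        have h2 : (expUnit : ℝ) ≤ ((expUnit - expUnit * a / (c * 65536) : ℕ) : ℝ) +
            ((expUnit * a / (c * 65536) : ℕ) : ℝ) := by
          exact_mod_cast (by omega : expUnit ≤ expUnit - expUnit * a / (c * 65536) +
            expUnit * a / (c * 65536))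
        push_cast at this
        linarith
      have h3 := cast_div_lt_add_one (expUnit * (a * a))
        (show 0 < 2 * (c * 65536 * (c * 65536)) by positivity)
      have h4 := mul_le_mul_of_nonneg_right (exp_neg_le_quadratic hy0) hE.le
      change Real.exp (-y) * expUnit ≤ ((expUnit - expUnit * a / (c * 65536) +
        (expUnit * (a * a) / (2 * (c * 65536 * (c * 65536))) + 1) : ℕ) : ℝ)
      rw [Nat.cast_add, Nat.cast_add, Nat.cast_one]
      push_cast at h3
      have h5 : (1 - y + y ^ 2 / 2) * expUnit = (expUnit : ℝ) - (expUnit * a / (c * 65536) : ℝ) +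
          expUnit * (a * a) / (2 * (c * 65536 * (c * 65536))) := by
        rw [hy]; field_simp
      linarith
    | succ n ih =>
      dsimp only
      rw [natSeq_eq]
      set x : ℕ := Nat.rec _ _ n
      rw [pow_succ, pow_mul, sq]
      have h := cast_div_lt_add_one (x * x) expUnit_pos
      have h2 := mul_le_mul ih ih (by positivity) (by positivity)
      refine h2.trans ?_
      rw [div_mul_div_comm, ← div_div]
      gcongr
      push_cast at h
      change _ ≤ ((x * x / expUnit + 1 : ℕ) : ℝ)
      rw [Nat.cast_add, Nat.cast_one]
      exact h.le
  have h := key 16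
  rw [← Real.exp_nat_mul] at h
  have he : ((2 ^ 16 : ℕ) : ℝ) * -y = -(a / c : ℝ) := by
    rw [hy]; push_cast; field_simp
  rw [he] at h
  exact h

/-- The distribution function of the Bernoulli convolution. -/
noncomputable def bernoulliCdf (β t : ℝ) : ℝ := (coin.map (piBeta β)).real (Set.Iic t)

theorem bernoulliCdf_eq {β : ℝ} (hβ : 1 < β) (t : ℝ) :
    bernoulliCdf β t = coin.real {ε | piBeta β ε ≤ t} := by
  rw [bernoulliCdf, map_measureReal_apply (measurable_piBeta hβ) measurableSet_Iic]
  rfl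

theorem bernoulliCdf_mono {β : ℝ} (hβ : 1 < β) {s t : ℝ} (h : s ≤ t) :
    bernoulliCdf β s ≤ bernoulliCdf β t := by
  rw [bernoulliCdf_eq hβ, bernoulliCdf_eq hβ]
  exact measureReal_mono fun ε hε => le_trans hε h

theorem bernoulliCdf_le_one {β : ℝ} (hβ : 1 < β) (t : ℝ) : bernoulliCdf β t ≤ 1 := by
  rw [bernoulliCdf_eq hβ]
  exact measureReal_le_one

theorem bernoulliCdf_of_neg {β : ℝ} (hβ : 1 < β) {t : ℝ} (ht : t < 0) : bernoulliCdf β t = 0 := by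
  rw [bernoulliCdf_eq hβ]
  convert measureReal_empty (μ := coin)
  ext ε
  simpa using ht.trans_le (piBeta_nonneg hβ ε)

theorem bernoulliCdf_self_similar {β : ℝ} (hβ : 1 < β) (t : ℝ) :
    bernoulliCdf β t = (bernoulliCdf β (β * t) + bernoulliCdf β (β * t - β + 1)) / 2 := by
  have hb : 0 < β := by linarith
  simp only [bernoulliCdf_eq hβ]
  have hm : MeasurableSet {ε | piBeta β ε ≤ t} := measurable_piBeta hβ measurableSet_Iic
  have h0 : consDigit 0 ⁻¹' {ε | piBeta β ε ≤ t} = {ε | piBeta β ε ≤ β * t} := by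
    ext ε
    simp only [Set.mem_preimage, Set.mem_ofPred_eq, piBeta_consDigit hβ]
    simp only [Fin.val_zero, Nat.cast_zero, mul_zero, zero_add]
    rw [div_le_iff₀ hb, mul_comm]
  have h1 : consDigit 1 ⁻¹' {ε | piBeta β ε ≤ t} = {ε | piBeta β ε ≤ β * t - β + 1} := by
    ext ε
    simp only [Set.mem_preimage, Set.mem_ofPred_eq, piBeta_consDigit hβ]
    simp only [Fin.val_one, Nat.cast_one, mul_one]
    have : 1 - 1 / β + piBeta β ε / β = (β - 1 + piBeta β ε) / β := by field_simp
    rw [this, div_le_iff₀ hb]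
    constructor <;> intro h <;> linarith
  have h : coin {ε | piBeta β ε ≤ t} = 2⁻¹ * coin {ε | piBeta β ε ≤ β * t} +
      2⁻¹ * coin {ε | piBeta β ε ≤ β * t - β + 1} := by
    rw [← h0, ← h1]
    conv_lhs => rw [coin_eq_consDigit]
    rw [Measure.add_apply, Measure.smul_apply, Measure.smul_apply,
      Measure.map_apply (measurable_consDigit 0) hm, Measure.map_apply (measurable_consDigit 1) hm]
    rfl
  rw [measureReal_def, h, ENNReal.toReal_add (by finiteness) (by finiteness), ENNReal.toReal_mul,
    ENNReal.toReal_mul, ← measureReal_def, ← measureReal_def]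
  simp only [ENNReal.toReal_inv, ENNReal.toReal_ofNat]
  ring

/-- `f` is an upper bound for the distribution function, in fixed-point arithmetic. -/
def IsCdfBound (β : ℝ) (f : ℕ → ℕ) : Prop :=
  ∀ hi : ℕ, bernoulliCdf β (hi / fpUnit) ≤ f hi / fpUnit

theorem cdfSum_succ (b₁ b₂ : ℕ) (leaf : ℕ → ℕ) (d hi : ℕ) :
    cdfSum b₁ b₂ leaf (d + 1) hi = if fpUnit ≤ hi then fpUnit * 2 ^ (d + 1) else
      cdfSum b₁ b₂ leaf d (b₂ * hi / fpUnit + 1) +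
        if b₁ * (fpUnit - hi) / fpUnit ≤ fpUnit then
          cdfSum b₁ b₂ leaf d (fpUnit - b₁ * (fpUnit - hi) / fpUnit) else 0 := by
  have h : cdfSum b₁ b₂ leaf (d + 1) hi =
      bif Nat.ble fpUnit hi then fpUnit * 2 ^ (d + 1) else
      natSeq (b₂ * hi / fpUnit + 1) (cdfSum b₁ b₂ leaf d) +
       natSeq (b₁ * (fpUnit - hi) / fpUnit)
        (fun u => bif Nat.ble u fpUnit then natSeq (fpUnit - u) (cdfSum b₁ b₂ leaf d) else 0) := rfl
  simp only [h, natSeq_eq, cond_eq_ite, Nat.ble_eq]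

theorem bernoulliCdf_le_cdfSum {β : ℝ} (hβ : 1 < β) {b₁ b₂ : ℕ} (h₁ : b₁ ≤ β * fpUnit)
    (h₂ : β * fpUnit ≤ b₂) {leaf : ℕ → ℕ} (hf : IsCdfBound β leaf) (d hi : ℕ) :
    bernoulliCdf β (hi / fpUnit) ≤ cdfSum b₁ b₂ leaf d hi / (fpUnit * 2 ^ d) := by
  have hS : (0 : ℝ) < fpUnit := by exact_mod_cast fpUnit_pos
  induction d generalizing hi with
  | zero =>
    rw [pow_zero, mul_one]
    exact hf hi
  | succ d ih =>
    rw [cdfSum_succ]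
    split_ifs with hle hu
    · refine (bernoulliCdf_le_one hβ _).trans_eq ?_
      push_cast
      field_simp
    all_goals
      have hlt : hi < fpUnit := not_le.mp hle
      have ha : bernoulliCdf β (β * (hi / fpUnit)) ≤ _ :=
        (bernoulliCdf_mono hβ ?_).trans (ih (b₂ * hi / fpUnit + 1))
      rotate_left
      · have h := cast_div_lt_add_one (b₂ * hi) fpUnit_pos
        have h3 : β * fpUnit * hi ≤ b₂ * hi := by gcongr
        push_cast at h ⊢
        rw [le_div_iff₀ hS]
        refine le_trans ?_ h.le
        rw [le_div_iff₀ hS]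
        refine le_of_eq_of_le ?_ h3
        field_simp
      have h4 : ((b₁ * (fpUnit - hi) / fpUnit : ℕ) : ℝ) ≤ β * (fpUnit - hi) := by
        refine Nat.cast_div_le.trans ?_
        rw [div_le_iff₀ hS]
        push_cast [hlt.le]
        have : (0 : ℝ) ≤ fpUnit - hi := by
          rw [sub_nonneg]; exact_mod_cast hlt.le
        nlinarith [mul_le_mul_of_nonneg_right h₁ this]
      rw [bernoulliCdf_self_similar hβ]
    · have hb : bernoulliCdf β (β * (hi / fpUnit) - β + 1) ≤ _ :=
        (bernoulliCdf_mono hβ ?_).trans (ih (fpUnit - b₁ * (fpUnit - hi) / fpUnit))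
      rotate_left
      · rw [le_div_iff₀ hS]
        push_cast [hu]
        have : (β * (hi / fpUnit) - β + 1) * fpUnit = fpUnit - β * (fpUnit - hi) := by
          field_simp
          ring
        linarith
      push_cast at ha hb ⊢
      rw [pow_succ, ← mul_assoc, ← div_div, add_div _ _ (_ * 2 ^ d : ℝ)]
      gcongr
    · rw [bernoulliCdf_of_neg hβ (t := β * (hi / fpUnit) - β + 1), add_zero, add_zero]
      · rw [pow_succ, ← mul_assoc, ← div_div]
        gcongr
      · have h5 : (fpUnit : ℝ) < (b₁ * (fpUnit - hi) / fpUnit : ℕ) := by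
          exact_mod_cast not_le.mp hu
        have : (β * (hi / fpUnit) - β + 1) * fpUnit = fpUnit - β * (fpUnit - hi) := by
          field_simp
          ring
        by_contra! h6
        nlinarith [mul_nonneg h6 hS.le]

theorem IsCdfBound.cdfUpper {β : ℝ} (hβ : 1 < β) {b₁ b₂ : ℕ} (h₁ : b₁ ≤ β * fpUnit)
    (h₂ : β * fpUnit ≤ b₂) {leaf : ℕ → ℕ} (hf : IsCdfBound β leaf) (d : ℕ) :
    IsCdfBound β (cdfUpper b₁ b₂ leaf d) := by
  intro hi
  refine (bernoulliCdf_le_cdfSum hβ h₁ h₂ hf d hi).trans ?_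
  have h := cast_div_lt_add_one (cdfSum b₁ b₂ leaf d hi) (show 0 < 2 ^ d by positivity)
  rw [mul_comm, ← div_div]
  change _ ≤ ((cdfSum b₁ b₂ leaf d hi / 2 ^ d + 1 : ℕ) : ℝ) / fpUnit
  push_cast at h ⊢
  gcongr

theorem isCdfBound_const {β : ℝ} (hβ : 1 < β) : IsCdfBound β fun _ => fpUnit := by
  intro hi
  rw [div_self (by exact_mod_cast fpUnit_pos.ne')]
  exact bernoulliCdf_le_one hβ _

/-- The entries of the table produced by `tableEncode`. -/
def tableEntry (f : ℕ → ℕ) (n j : ℕ) : ℕ := min (f ((j + 1) * fpUnit / n + 1)) fpUnit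

theorem tableEncode_succ (f : ℕ → ℕ) (n k : ℕ) :
    tableEncode f n (k + 1) = tableBase ^ k * tableEntry f n k + tableEncode f n k := by
  have h : tableEncode f n (k + 1) = tableBase ^ k * natSeq ((k + 1) * fpUnit / n + 1)
    (fun x => natSeq (f x) (fun y => bif Nat.ble y fpUnit then y else fpUnit)) +
      tableEncode f n k := rfl
  simp only [h, natSeq_eq, cond_eq_ite, Nat.ble_eq, tableEntry, min_def]

theorem tableEntry_lt (f : ℕ → ℕ) (n j : ℕ) : tableEntry f n j < tableBase :=
  (min_le_right _ _).trans_lt (by norm_num [fpUnit, tableBase])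

theorem tableEncode_lt (f : ℕ → ℕ) (n k : ℕ) : tableEncode f n k < tableBase ^ k := by
  induction k with
  | zero => exact Nat.one_pos
  | succ k ih =>
    rw [tableEncode_succ, pow_succ]
    nlinarith [tableEntry_lt f n k]

theorem tableEncode_div_mod (f : ℕ → ℕ) (n : ℕ) {j k : ℕ} (h : j < k) :
    tableEncode f n k / tableBase ^ j % tableBase = tableEntry f n j := by
  have hB : 0 < tableBase := by norm_num [tableBase]
  induction k with
  | zero => omega
  | succ k ih =>
    rw [tableEncode_succ]
    rcases Nat.lt_succ_iff_lt_or_eq.mp h with hj | rfl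
    · obtain ⟨i, rfl⟩ := Nat.exists_eq_add_of_lt hj
      rw [show tableBase ^ (j + i + 1) = tableBase ^ j * (tableBase * tableBase ^ i) by ring,
        mul_assoc, Nat.mul_add_div (pow_pos hB j), mul_assoc, Nat.mul_add_mod, ih hj]
    · rw [Nat.mul_add_div (pow_pos hB j), Nat.div_eq_of_lt (tableEncode_lt f n j), add_zero,
        Nat.mod_eq_of_lt (tableEntry_lt f n j)]

theorem IsCdfBound.decode_encode {β : ℝ} (hβ : 1 < β) {f : ℕ → ℕ} (hf : IsCdfBound β f) {n : ℕ}
    (hn : 0 < n) : IsCdfBound β (tableDecode n (tableEncode f n n)) := by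
  intro hi
  have hS : (0 : ℝ) < fpUnit := by exact_mod_cast fpUnit_pos
  have h : tableDecode n (tableEncode f n n) hi = bif Nat.ble fpUnit hi then fpUnit else
      tableEncode f n n / tableBase ^ (hi * n / fpUnit) % tableBase := rfl
  simp only [h, cond_eq_ite, Nat.ble_eq]
  split_ifs with hle
  · exact isCdfBound_const hβ hi
  rw [not_le] at hle
  rw [tableEncode_div_mod f n (by
    rw [Nat.div_lt_iff_lt_mul fpUnit_pos, mul_comm]; gcongr), tableEntry]
  rcases min_cases (f ((hi * n / fpUnit + 1) * fpUnit / n + 1)) fpUnit with h | h <;> rw [h.1]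
  · refine (bernoulliCdf_mono hβ ?_).trans (hf _)
    gcongr
    have h1 := Nat.lt_mul_div_succ (hi * n) fpUnit_pos
    have h2 := Nat.lt_mul_div_succ ((hi * n / fpUnit + 1) * fpUnit) hn
    have h3 : n * hi < n * ((hi * n / fpUnit + 1) * fpUnit / n + 1) := by nlinarith
    exact (Nat.lt_of_mul_lt_mul_left h3).le
  · exact isCdfBound_const hβ hi

theorem exists_isCdfBound_of_withStages {β : ℝ} (hβ : 1 < β) {b₁ b₂ : ℕ} (h₁ : b₁ ≤ β * fpUnit)
    (h₂ : β * fpUnit ≤ b₂) {k : (ℕ → ℕ) → Bool} {l : List (ℕ × ℕ)} {leaf : ℕ → ℕ}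
    (hf : IsCdfBound β leaf) (h : withStages b₁ b₂ k l leaf = true) :
    ∃ leaf', IsCdfBound β leaf' ∧ k leaf' = true := by
  induction l generalizing leaf with
  | nil => exact ⟨leaf, hf, h⟩
  | cons p l ih =>
    have h' : (bif Nat.ble 1 p.1 then
      natSeq (tableEncode (cdfUpper b₁ b₂ leaf p.2) p.1 p.1)
        (fun T => withStages b₁ b₂ k l (tableDecode p.1 T)) else false) = true := h
    simp only [cond_eq_ite, Nat.ble_eq, natSeq_eq] at h'
    split_ifs at h' with hp
    · exact ih ((hf.cdfUpper hβ h₁ h₂ p.2).decode_encode hβ hp) h'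

theorem weightWhere_cons (p : ℕ → Bool) (m : ℕ) (e : ℕ × ℕ) (l : List (ℕ × ℕ)) :
    weightWhere p m (e :: l) = (if p e.1 then e.2 else 0) + weightWhere p m l := by
  have h : weightWhere p m (e :: l) =
    bif p e.1 then e.2 + weightWhere p m l else weightWhere p m l := rfl
  rw [h]
  cases p e.1 <;> simp

theorem weightWhere_mono {p q : ℕ → Bool} (m : ℕ) {l : List (ℕ × ℕ)}
    (h : ∀ e ∈ l, p e.1 → q e.1) : weightWhere p m l ≤ weightWhere q m l := by
  induction l with
  | nil => exact le_rfl
  | cons e l ih =>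
    rw [weightWhere_cons, weightWhere_cons]
    have h1 := ih fun e he => h e (List.mem_cons_of_mem _ he)
    have h2 := h e List.mem_cons_self
    split_ifs <;> first | omega | tauto

theorem le_weightWhere (p : ℕ → Bool) (m : ℕ) (l : List (ℕ × ℕ)) : m ≤ weightWhere p m l := by
  induction l with
  | nil => exact le_rfl
  | cons e l ih => rw [weightWhere_cons]; omega

/-- The step function with jumps at the points `s * L / den`. -/
noncomputable def stepPotential (den W m : ℕ) (l : List (ℕ × ℕ)) (L y : ℝ) : ℝ :=
  weightWhere (fun s => decide (y * den ≤ s * L)) m l / W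

theorem stepPotential_nonneg (den W m : ℕ) (l : List (ℕ × ℕ)) (L y : ℝ) :
    0 ≤ stepPotential den W m l L y := by
  rw [stepPotential]; positivity

theorem stepPotential_antitone (den W m : ℕ) (l : List (ℕ × ℕ)) (L : ℝ) :
    Antitone (stepPotential den W m l L) := by
  intro x y hxy
  rw [stepPotential, stepPotential]
  gcongr
  refine weightWhere_mono m fun e _ h => ?_
  rw [decide_eq_true_eq] at h ⊢
  refine le_trans ?_ h
  gcongr

theorem stepPotential_le (den W m : ℕ) (l : List (ℕ × ℕ)) (L y : ℝ) :
    stepPotential den W m l L y ≤ weightWhere (fun _ => true) m l / W := by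
  rw [stepPotential]
  gcongr
  exact weightWhere_mono m fun _ _ _ => rfl

theorem exp_add_exp_le_one_of_expUpper {A B W : ℕ} (hW : 0 < W)
    (h : expUpper A W + expUpper B W ≤ expUnit) {v w : ℝ} (hv : (A / W : ℝ) ≤ v)
    (hw : (B / W : ℝ) ≤ w) : Real.exp (-v) + Real.exp (-w) ≤ 1 := by
  have hE : (0 : ℝ) < expUnit := by exact_mod_cast expUnit_pos
  have h1 := exp_neg_le_expUpper A hW
  have h2 := exp_neg_le_expUpper B hW
  have h3 : Real.exp (-v) ≤ Real.exp (-(A / W : ℝ)) := by gcongr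
  have h4 : Real.exp (-w) ≤ Real.exp (-(B / W : ℝ)) := by gcongr
  have h5 : (expUpper A W / expUnit + expUpper B W / expUnit : ℝ) ≤ 1 := by
    rw [← add_div, div_le_one hE]
    exact_mod_cast h
  linarith

theorem sepCheck_eq_true {den W m : ℕ} {l l' : List (ℕ × ℕ)} (h : sepCheck den W m l l' = true) :
    expUpper (weightWhere (fun _ => true) m l) W + expUpper m W ≤ expUnit ∧
    ∀ e ∈ l', expUpper (weightWhere (fun t => Nat.ble (e.1 + 1) t) m l) W +
      expUpper (weightWhere (fun t => Nat.ble den (e.1 + t)) m l) W ≤ expUnit := by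
  induction l' with
  | nil =>
    have h' : natSeq (weightWhere (fun _ => true) m l) (fun A =>
      Nat.ble (expUpper A W + expUpper m W) expUnit) = true := h
    rw [natSeq_eq] at h'
    exact ⟨Nat.le_of_ble_eq_true h', by simp⟩
  | cons e l' ih =>
    have h' : (bif sepCheckAt den W m l e.1 then sepCheck den W m l l' else false) = true := h
    rw [Bool.cond_false_right, Bool.and_eq_true] at h'
    obtain ⟨h1, h2⟩ := h'
    rw [sepCheckAt, natSeq_eq, natSeq_eq] at h1
    refine ⟨(ih h2).1, fun e' he' => ?_⟩
    rcases List.mem_cons.mp he' with rfl | he'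
    · exact Nat.le_of_ble_eq_true h1
    · exact (ih h2).2 e' he'

theorem stepPotential_separated {den W m : ℕ} {l : List (ℕ × ℕ)} (hW : 0 < W)
    (h : sepCheck den W m l l = true) {L : ℝ} (hL : 0 < L) (y : ℝ) :
    Real.exp (-stepPotential den W m l L y) + Real.exp (-stepPotential den W m l L (L - y)) ≤
      1 := by
  obtain ⟨h0, h1⟩ := sepCheck_eq_true h
  by_cases hex : ∃ e ∈ l, e.1 * L < y * den
  · obtain ⟨e, he, hmax⟩ := (l.toFinset.filter fun e => e.1 * L < y * den).exists_max_image
      (fun e => e.1) (by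
        obtain ⟨e, he, hl⟩ := hex
        exact ⟨e, by simpa using ⟨he, hl⟩⟩)
    rw [Finset.mem_filter, List.mem_toFinset] at he
    refine exp_add_exp_le_one_of_expUpper hW (h1 e he.1) ?_ ?_ <;> rw [stepPotential] <;> gcongr <;>
      refine weightWhere_mono m fun t ht hle => ?_ <;> replace hle := Nat.le_of_ble_eq_true hle <;>
      rw [decide_eq_true_eq]
    · by_contra! hlt
      have := hmax t (by rw [Finset.mem_filter, List.mem_toFinset]; exact ⟨ht, hlt⟩)
      omega
    · have h3 : (den : ℝ) ≤ e.1 + t.1 := by exact_mod_cast hle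
      nlinarith [mul_le_mul_of_nonneg_right h3 hL.le]
  · push Not at hex
    refine exp_add_exp_le_one_of_expUpper hW h0 ?_ ?_ <;> rw [stepPotential] <;> gcongr
    · exact weightWhere_mono m fun t ht _ => by simpa using hex t ht
    · exact le_weightWhere _ _ _

theorem integral_weightWhere_le {β : ℝ} (hβ : 1 < β) (hβ2 : β < 2) {b₁ : ℕ}
    (h₁ : b₁ ≤ β * fpUnit) {den : ℕ} (hden : 0 < den) (m : ℕ) (l : List (ℕ × ℕ)) {f : ℕ → ℕ → ℕ}
    (hf : ∀ s, IsCdfBound β (f s)) :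
    Integrable (fun x : ℝ => (weightWhere
      (fun s => decide ((x - 1 / fpUnit) * den ≤ s * (2 - β))) m l : ℝ))
      (coin.map (piBeta β)) ∧
    ∫ x, (weightWhere (fun s => decide ((x - 1 / fpUnit) * den ≤ s * (2 - β))) m l : ℝ)
      ∂(coin.map (piBeta β)) ≤ integralUpper f b₁ den m l / fpUnit := by
  have hS : (0 : ℝ) < fpUnit := by exact_mod_cast fpUnit_pos
  have hd : (0 : ℝ) < den := by exact_mod_cast hden
  have : IsProbabilityMeasure (coin.map (piBeta β)) :=
    Measure.isProbabilityMeasure_map (measurable_piBeta hβ).aemeasurable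
  induction l with
  | nil =>
    refine ⟨integrable_const (m : ℝ), ?_⟩
    change ∫ _, (m : ℝ) ∂_ ≤ ((m * fpUnit : ℕ) : ℝ) / fpUnit
    rw [integral_const, probReal_univ, one_smul]
    push_cast
    rw [mul_div_cancel_right₀ _ hS.ne']
  | cons e l ih =>
    set t : ℝ := e.1 * (2 - β) / den + 1 / fpUnit with ht
    have hind : (fun x : ℝ => (weightWhere
        (fun s => decide ((x - 1 / fpUnit) * den ≤ s * (2 - β))) m (e :: l) : ℝ)) =
        fun x => (Set.Iic t).indicator (fun _ => (e.2 : ℝ)) x + (weightWhere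
          (fun s => decide ((x - 1 / fpUnit) * den ≤ s * (2 - β))) m l : ℝ) := by
      ext x
      rw [weightWhere_cons, Nat.cast_add, Set.indicator_apply]
      have : (x - 1 / fpUnit) * den ≤ e.1 * (2 - β) ↔ x ∈ Set.Iic t := by
        rw [Set.mem_Iic, ht, ← sub_le_iff_le_add, le_div_iff₀ hd]
      simp only [decide_eq_true_eq, this]
      split_ifs <;> simp
    have hi : Integrable ((Set.Iic t).indicator fun _ : ℝ => (e.2 : ℝ)) (coin.map (piBeta β)) :=
      (integrable_const _).indicator measurableSet_Iic
    rw [hind]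
    refine ⟨hi.add ih.1, ?_⟩
    rw [integral_add hi ih.1, integral_indicator_const _ measurableSet_Iic, smul_eq_mul]
    have h : integralUpper f b₁ den m (e :: l) = e.2 *
      (natSeq (2 + (2 * fpUnit - b₁) * e.1 / den) (f e.1)) + integralUpper f b₁ den m l := rfl
    rw [h, natSeq_eq, Nat.cast_add, add_div]
    refine add_le_add ?_ ih.2
    rw [mul_comm, Nat.cast_mul, mul_div_assoc]
    gcongr
    refine (bernoulliCdf_mono hβ ?_).trans (hf e.1 _)
    have hb : b₁ ≤ 2 * fpUnit := by
      have : (b₁ : ℝ) ≤ 2 * fpUnit := by nlinarith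
      exact_mod_cast this
    have h2 := cast_div_lt_add_one ((2 * fpUnit - b₁) * e.1) hden
    push_cast [hb] at h2 ⊢
    rw [le_div_iff₀ hS, ht, add_mul, one_div, inv_mul_cancel₀ hS.ne']
    have h3 : (e.1 * (2 - β) / den * fpUnit : ℝ) ≤ (2 * fpUnit - b₁) * e.1 / den := by
      rw [div_mul_eq_mul_div]
      refine div_le_div_of_nonneg_right ?_ hd.le
      have : (2 - β) * fpUnit ≤ 2 * fpUnit - b₁ := by linarith
      nlinarith [mul_le_mul_of_nonneg_left this (Nat.cast_nonneg (α := ℝ) e.1)]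
    linarith

theorem DimCert.isFrostman {c : DimCert} {b₁ : ℕ} (hc : c.check b₁ = true) {β : ℝ} (hβ : 1 < β)
    (hβ2 : β < 2) (h₁ : b₁ ≤ β * fpUnit) (h₂ : β * fpUnit ≤ c.b) :
    IsFrostman (coin.map (piBeta β)) 0.98040856 := by
  have hS : (0 : ℝ) < fpUnit := by exact_mod_cast fpUnit_pos
  have hE : (0 : ℝ) < expUnit := by exact_mod_cast expUnit_pos
  simp only [DimCert.check, Bool.cond_false_right, Bool.and_eq_true] at hc
  obtain ⟨hden, hW, hlog, hsep, hst⟩ := hc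
  replace hden : 0 < c.den := Nat.le_of_ble_eq_true hden
  replace hW : 0 < c.W := Nat.le_of_ble_eq_true hW
  replace hlog : expUpper c.logB fpUnit * c.b ≤ expUnit * fpUnit := Nat.le_of_ble_eq_true hlog
  obtain ⟨leaf, hleaf, hint⟩ :=
    exists_isCdfBound_of_withStages hβ h₁ h₂ (isCdfBound_const hβ) hst
  replace hint := Nat.le_of_ble_eq_true hint
  have hlogβ : Real.log β ≤ c.logB / fpUnit := by
    have h := mul_le_mul (exp_neg_le_expUpper c.logB fpUnit_pos) h₂ (by positivity) (by positivity)
    have h3 : (expUpper c.logB fpUnit * c.b : ℝ) ≤ expUnit * fpUnit := by exact_mod_cast hlog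
    rw [Real.log_le_iff_le_exp (by linarith)]
    rw [div_mul_eq_mul_div, le_div_iff₀ hE, Real.exp_neg] at h
    have h4 : β * (expUnit * fpUnit) ≤
        Real.exp (c.logB / fpUnit) * (expUpper c.logB fpUnit * c.b) := by
      refine le_trans (le_of_eq ?_) (mul_le_mul_of_nonneg_left h (Real.exp_pos _).le)
      field_simp
    have h5 := h4.trans (mul_le_mul_of_nonneg_left h3 (Real.exp_pos _).le)
    exact le_of_mul_le_mul_right h5 (by positivity)
  have hint' := (integral_weightWhere_le hβ hβ2 h₁ hden c.m c.steps (fun s =>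
    hleaf.cdfUpper hβ h₁ h₂ (bif Nat.ble 1 s then c.depth else 30 + c.depth))).2
  set I := integralUpper _ b₁ c.den c.m c.steps
  have hint2 : (100000000000000000000 * I + 98040856 * c.logB * (c.W * fpUnit) : ℝ) ≤
      69314718030000000000 * (c.W * fpUnit) := by exact_mod_cast hint
  have hlogpos : 0 < Real.log β := Real.log_pos hβ
  have h := isFrostman_of_potential hβ (stepPotential_antitone c.den c.W c.m c.steps (2 - β))
    (stepPotential_nonneg _ _ _ _ _) (stepPotential_le _ _ _ _ _)
    (stepPotential_separated hW hsep (by linarith)) (κ := 1 / fpUnit) (by positivity)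
    (h := Real.log 2 - 0.98040856 * Real.log β) (by
      have hW' : (0 : ℝ) < c.W := by exact_mod_cast hW
      have hS1 : (fpUnit : ℝ) = 1000000000000 := by norm_num [fpUnit]
      simp only [stepPotential]
      rw [integral_div, div_le_iff₀ hW']
      refine hint'.trans ?_
      rw [div_le_iff₀ hS]
      have h2 := Real.log_two_gt_d9
      have h3 : Real.log β * fpUnit ≤ c.logB := by rwa [← le_div_iff₀ hS]
      have h4 : 0.98040856 * (Real.log β * fpUnit) * c.W ≤ 0.98040856 * c.logB * c.W := by gcongr
      have h5 : 0.6931471803 * (c.W * fpUnit) ≤ Real.log 2 * (c.W * fpUnit) := by gcongr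
      rw [hS1] at hint2 h3 h4 h5 ⊢
      linarith)
  rwa [sub_sub_cancel, mul_div_cancel_right₀ _ hlogpos.ne'] at h

theorem isFrostman_of_checkChain {b₂ : ℕ} {l : List DimCert} {b₁ : ℕ}
    (h : checkChain b₂ l b₁ = true) {β : ℝ} (hβ : 1 < β) (hβ2 : β < 2) (h₁ : b₁ ≤ β * fpUnit)
    (h₂ : β * fpUnit < b₂) : IsFrostman (coin.map (piBeta β)) 0.98040856 := by
  induction l generalizing b₁ with
  | nil =>
    have h3 : (b₂ : ℝ) ≤ b₁ := by exact_mod_cast Nat.le_of_ble_eq_true h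
    linarith
  | cons c l ih =>
    have h' : (bif c.check b₁ then checkChain b₂ l c.b else false) = true := h
    rw [Bool.cond_false_right, Bool.and_eq_true] at h'
    rcases le_total (β * fpUnit) c.b with h3 | h3
    · exact c.isFrostman h'.1 hβ hβ2 h₁ h3
    · exact ih h'.2 h3

theorem checkChain_upTo_1531 :
    checkChain 1531527000000 [
  ⟨1416097000000, 347904495790, [(16, 6), (64, 6)], 9, 16, 10000, 1,
      [(0, 209163), (1, 9651), (2, 4281), (3, 2585), (4, 1892), (5, 1802), (6, 1653), (7, 2041),
    (9, 1695), (10, 997), (11, 835), (12, 676), (13, 690), (14, 758), (15, 812), (16, 468)]⟩,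
  ⟨1418657000000, 349710649478, [(16, 6), (64, 6)], 9, 32, 10000, 1,
      [(0, 203379), (1, 9461), (2, 4534), (3, 4011), (5, 3249), (7, 2098), (9, 1255), (10, 1389),
    (12, 1649), (14, 1123), (15, 920), (17, 843), (18, 853), (20, 995), (22, 662), (23, 495), (25,
    661), (27, 733), (29, 590), (30, 415), (31, 424), (32, 260)]⟩,
  ⟨1421278000000, 351556466896, [(16, 6), (64, 6)], 9, 32, 10000, 1,
      [(0, 203372), (1, 9782), (2, 4465), (3, 3885), (5, 3130), (7, 2566), (10, 2254), (12, 1190),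
    (13, 1161), (15, 1263), (17, 1122), (19, 828), (20, 699), (22, 1025), (25, 835), (27, 711),
    (29, 584), (30, 421), (31, 447), (32, 259)]⟩,
  ⟨1423961000000, 353442425014, [(16, 6), (64, 6)], 9, 32, 10000, 1,
      [(0, 203510), (1, 9897), (2, 4310), (3, 3901), (5, 3107), (7, 2064), (9, 1778), (11, 1710),
    (13, 1577), (15, 1214), (17, 1083), (19, 1097), (21, 913), (23, 735), (25, 656), (27, 715),
    (29, 593), (30, 414), (31, 462), (32, 263)]⟩,
  ⟨1426708000000, 355369692508, [(16, 6), (64, 6)], 9, 32, 10000, 1,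
      [(0, 204222), (1, 9338), (2, 4310), (3, 3833), (5, 3120), (7, 1984), (9, 1796), (11, 1680),
    (13, 1583), (15, 1202), (17, 1073), (19, 1103), (21, 900), (23, 745), (25, 636), (27, 725),
    (29, 591), (30, 421), (31, 454), (32, 283)]⟩,
  ⟨1429520000000, 357338723628, [(16, 6), (64, 6)], 9, 32, 10000, 1,
      [(0, 204275), (1, 9562), (2, 4199), (3, 3756), (5, 3109), (7, 2420), (10, 2222), (12, 1138),
    (13, 1217), (15, 1170), (17, 1048), (19, 878), (20, 675), (22, 1026), (25, 808), (27, 730),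
    (29, 588), (30, 420), (31, 474), (32, 284)]⟩,
  ⟨1432399000000, 359350661052, [(16, 6), (64, 6)], 9, 32, 10000, 1,
      [(0, 204313), (1, 12117), (3, 5448), (5, 3137), (7, 1827), (9, 1854), (11, 1643), (13,
    1604), (15, 1125), (17, 1012), (19, 1130), (21, 890), (23, 776), (25, 594), (27, 747), (29,
    788), (31, 709), (32, 285)]⟩,
  ⟨1435347000000, 361406631866, [(16, 6), (64, 6)], 9, 32, 10000, 1,
      [(0, 204991), (1, 11608), (3, 5355), (5, 3115), (7, 1839), (9, 1833), (11, 1613), (13,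
    1618), (15, 1096), (17, 988), (19, 1145), (21, 878), (23, 773), (25, 603), (27, 747), (29,
    785), (31, 706), (32, 306)]⟩,
  ⟨1438365000000, 363507051887, [(16, 6), (64, 6)], 9, 32, 10000, 1,
      [(0, 205043), (1, 9491), (2, 5376), (4, 4574), (7, 2426), (9, 1926), (11, 1550), (13, 1626),
    (15, 1056), (17, 956), (19, 1157), (21, 852), (23, 818), (25, 767), (28, 941), (30, 625), (31,
    508), (32, 307)]⟩,
  ⟨1441455000000, 365653020167, [(16, 6), (64, 6)], 9, 32, 10000, 1,
      [(0, 205672), (1, 9027), (2, 5323), (4, 4574), (7, 2345), (9, 1940), (11, 1507), (13, 1679),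
    (15, 1001), (17, 910), (19, 1202), (21, 831), (23, 829), (25, 748), (28, 954), (30, 627), (31,
    502), (32, 328)]⟩,
  ⟨1444619000000, 367845619017, [(16, 6), (64, 6)], 9, 32, 10000, 1,
      [(0, 205780), (1, 9254), (2, 5077), (4, 4560), (7, 2328), (9, 1953), (11, 1461), (13, 1692),
    (15, 963), (17, 879), (19, 1217), (21, 812), (23, 842), (25, 749), (28, 961), (30, 612), (31,
    528), (32, 331)]⟩,
  ⟨1447858000000, 370085222896, [(16, 6), (64, 6)], 9, 32, 10000, 1,
      [(0, 206397), (1, 8780), (2, 5076), (4, 4478), (7, 2811), (10, 2613), (13, 1993), (15, 920),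
    (17, 843), (19, 1410), (22, 1286), (25, 944), (28, 954), (30, 622), (31, 519), (32, 353)]⟩,
  ⟨1449980000000, 371549763273, [(8, 5), (32, 5)], 9, 32, 10000, 1,
      [(0, 206995), (1, 8597), (2, 4740), (4, 3928), (6, 2926), (10, 2995), (13, 2887), (19,
    2238), (22, 1441), (26, 930), (28, 815), (30, 596), (31, 536), (32, 375)]⟩,
  ⟨1452152000000, 373046594159, [(8, 5), (32, 5)], 9, 32, 10000, 1,
      [(0, 207188), (1, 12002), (4, 5654), (7, 2795), (10, 2558), (13, 2871), (19, 2228), (22,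
    1271), (25, 952), (28, 1147), (31, 950), (32, 383)]⟩,
  ⟨1454376000000, 374576942694, [(8, 5), (32, 5)], 9, 32, 10000, 1,
      [(0, 207422), (1, 11953), (4, 4931), (6, 2434), (9, 3115), (13, 3213), (19, 2428), (23,
    1417), (26, 752), (28, 975), (31, 967), (32, 392)]⟩,
  ⟨1456653000000, 376141338284, [(8, 5), (32, 5)], 9, 32, 10000, 1,
      [(0, 208458), (1, 9263), (3, 6600), (7, 3301), (10, 2688), (13, 2758), (19, 2160), (22,
    1346), (25, 1087), (29, 1198), (31, 704), (32, 436)]⟩,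
  ⟨1458984000000, 377740303105, [(8, 5), (32, 5)], 9, 32, 10000, 1,
      [(0, 213094), (2, 7568), (4, 3827), (6, 2814), (10, 3035), (13, 2730), (19, 2143), (22,
    1491), (26, 915), (28, 821), (30, 859), (32, 702)]⟩,
  ⟨1461370000000, 379374351943, [(8, 5), (32, 5)], 9, 32, 10000, 1,
      [(0, 208727), (1, 9168), (3, 5901), (6, 3553), (10, 3011), (13, 2708), (19, 2129), (22,
    1487), (26, 1111), (29, 1043), (31, 713), (32, 448)]⟩,
  ⟨1463813000000, 381044675180, [(8, 5), (32, 5)], 9, 32, 10000, 1,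
      [(0, 208815), (1, 9274), (3, 5700), (6, 3133), (9, 3112), (13, 3034), (19, 2325), (23,
    1454), (26, 950), (29, 1017), (31, 733), (32, 452)]⟩,
  ⟨1466314000000, 382751768836, [(8, 5), (32, 5)], 9, 32, 10000, 1,
      [(0, 208785), (1, 9369), (3, 6401), (7, 3283), (10, 2595), (13, 2635), (19, 2084), (22,
    1333), (25, 1114), (29, 1207), (31, 743), (32, 450)]⟩,
  ⟨1468875000000, 384496801711, [(8, 5), (32, 5)], 9, 32, 10000, 1,
      [(0, 213378), (2, 7851), (4, 3484), (6, 2774), (10, 3031), (13, 2550), (19, 2030), (22,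
    1531), (26, 927), (28, 783), (30, 937), (32, 723)]⟩,
  ⟨1471497000000, 386280249993, [(8, 5), (32, 5)], 9, 32, 10000, 1,
      [(0, 209560), (1, 8633), (3, 5942), (6, 2870), (9, 3159), (13, 2904), (19, 2248), (23,
    1500), (26, 894), (29, 1091), (31, 710), (32, 488)]⟩,
  ⟨1474181000000, 388102581383, [(8, 5), (32, 5)], 9, 32, 10000, 1,
      [(0, 209517), (1, 8895), (3, 5751), (6, 3413), (10, 3077), (13, 2415), (19, 1944), (22,
    1581), (26, 1110), (29, 1070), (31, 740), (32, 486)]⟩,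
  ⟨1476929000000, 389964932020, [(8, 5), (32, 5)], 9, 16, 10000, 1,
      [(0, 213648), (1, 8101), (2, 3003), (3, 2886), (5, 3380), (7, 2050), (9, 1701), (11, 1799),
    (13, 977), (14, 697), (15, 1013), (16, 744)]⟩,
  ⟨1479742000000, 391867748295, [(8, 5), (32, 5)], 9, 16, 10000, 1,
      [(0, 213873), (1, 7999), (2, 3018), (3, 2770), (5, 2821), (6, 1605), (8, 1877), (10, 1159),
    (11, 1437), (13, 947), (14, 712), (15, 1020), (16, 761)]⟩,
  ⟨1482622000000, 393812141967, [(8, 5), (32, 5)], 9, 16, 10000, 1,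
      [(0, 214093), (1, 7873), (2, 2926), (3, 2868), (5, 2730), (6, 1592), (8, 1884), (10, 1150),
    (11, 1401), (13, 988), (14, 694), (15, 1021), (16, 779)]⟩,
  ⟨1485571000000, 395799210173, [(8, 5), (32, 5)], 9, 16, 10000, 1,
      [(0, 214147), (1, 9559), (3, 4078), (5, 2835), (6, 1489), (8, 1836), (10, 1090), (11, 1473),
    (13, 1310), (15, 1399), (16, 783)]⟩,
  ⟨1488590000000, 397829363239, [(8, 5), (32, 5)], 9, 32, 10000, 1,
      [(0, 210134), (1, 9183), (3, 5736), (7, 2709), (9, 3065), (14, 2241), (18, 1830), (23,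
    1619), (25, 942), (29, 1189), (31, 834), (32, 517)]⟩,
  ⟨1491681000000, 399903671991, [(8, 5), (32, 5)], 9, 16, 10000, 1,
      [(0, 214623), (1, 7791), (2, 2680), (3, 2831), (5, 3266), (7, 1877), (9, 1580), (11, 1800),
    (13, 1000), (14, 661), (15, 1067), (16, 823)]⟩,
  ⟨1494846000000, 402023191543, [(8, 5), (32, 5)], 9, 32, 10000, 1,
      [(0, 214895), (2, 8412), (5, 3779), (9, 2780), (11, 2029), (16, 2223), (21, 1372), (23,
    1295), (27, 1127), (30, 1240), (32, 847)]⟩,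
  ⟨1498086000000, 404188293366, [(8, 5), (32, 5)], 9, 16, 10000, 1,
      [(0, 215094), (1, 7467), (2, 3771), (4, 2511), (5, 2813), (8, 2650), (11, 1723), (12, 1028),
    (14, 1021), (15, 1057), (16, 864)]⟩,
  ⟨1501403000000, 406400004329, [(8, 5), (32, 5)], 9, 32, 10000, 1,
      [(0, 215214), (2, 9512), (7, 4422), (11, 2734), (16, 2247), (21, 1748), (25, 1675), (30,
    1572), (32, 875)]⟩,
  ⟨1504799000000, 408659334504, [(8, 5), (32, 5)], 9, 16, 10000, 1,
      [(0, 215741), (1, 8422), (3, 4123), (5, 3393), (8, 2609), (11, 2002), (13, 1413), (15,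
    1371), (16, 925)]⟩,
  ⟨1509145000000, 411543265335, [(8, 5), (32, 5)], 9, 32, 10000, 1,
      [(0, 211891), (1, 6874), (2, 4090), (4, 3095), (7, 2910), (10, 2647), (15, 1561), (17,
    1350), (22, 1603), (25, 1163), (28, 830), (30, 712), (31, 653), (32, 620)]⟩,
  ⟨1513595000000, 414487615967, [(8, 5), (32, 5)], 9, 32, 10000, 1,
      [(0, 212284), (1, 8303), (3, 4996), (7, 3428), (10, 2517), (15, 1540), (17, 1335), (22,
    1543), (25, 1355), (29, 1149), (31, 903), (32, 646)]⟩,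
  ⟨1518151000000, 417493147057, [(8, 5), (32, 5)], 9, 32, 10000, 1,
      [(0, 212395), (1, 8346), (3, 4966), (7, 3446), (10, 2375), (15, 1540), (17, 1335), (22,
    1472), (25, 1387), (29, 1162), (31, 922), (32, 653)]⟩,
  ⟨1522816000000, 420561252471, [(8, 5), (32, 5)], 9, 32, 10000, 1,
      [(0, 213123), (1, 6291), (2, 4042), (4, 2724), (7, 3104), (10, 2263), (15, 1521), (17,
    1320), (22, 1419), (25, 1301), (28, 769), (30, 757), (31, 661), (32, 704)]⟩,
  ⟨1526637000000, 423067276994, [(8, 5), (32, 5)], 9, 16, 10000, 1,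
      [(0, 217005), (1, 7821), (3, 4070), (5, 2824), (8, 2536), (11, 1747), (13, 1521), (15,
    1418), (16, 1057)]⟩,
  ⟨1531527000000, 426265276950, [(8, 5), (32, 5)], 9, 16, 10000, 1,
      [(0, 217208), (1, 6606), (2, 2115), (3, 2390), (4, 1496), (5, 1883), (8, 2575), (11, 1246),
    (12, 756), (13, 916), (14, 600), (15, 1129), (16, 1079)]⟩]
      1414000000000 = true := by
  decide +kernel

theorem checkChain_upTo_1721 :
    checkChain 1721978000000 [
  ⟨1536534000000, 429529230597, [(8, 5), (32, 5)], 9, 32, 10000, 1,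
      [(0, 213976), (1, 8867), (4, 3783), (7, 3072), (10, 1873), (15, 1497), (17, 1302), (22,
    1214), (25, 1370), (28, 1063), (31, 1213), (32, 769)]⟩,
  ⟨1541661000000, 432860406653, [(8, 5), (32, 5)], 9, 32, 10000, 1,
      [(0, 217825), (2, 6848), (5, 2740), (7, 2640), (11, 1698), (15, 1317), (17, 1164), (21,
    1150), (25, 1276), (27, 909), (30, 1280), (32, 1152)]⟩,
  ⟨1546911000000, 436260039271, [(8, 5), (32, 5)], 9, 32, 10000, 1,
      [(0, 214576), (1, 7666), (3, 4327), (7, 3577), (11, 1620), (15, 1302), (17, 1152), (21,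
    1107), (25, 1647), (29, 1170), (31, 1036), (32, 819)]⟩,
  ⟨1552287000000, 439729327385, [(8, 5), (32, 5)], 9, 32, 10000, 1,
      [(0, 215249), (1, 7216), (3, 4311), (7, 3416), (11, 1623), (15, 1253), (17, 1114), (21,
    1117), (25, 1601), (29, 1198), (31, 1022), (32, 879)]⟩,
  ⟨1557792000000, 443269434083, [(8, 5), (32, 5)], 9, 32, 10000, 1,
      [(0, 218850), (2, 7051), (6, 4032), (11, 1927), (15, 1208), (17, 1078), (21, 1306), (26,
    1748), (30, 1514), (32, 1285)]⟩,
  ⟨1563429000000, 446881485987, [(8, 5), (32, 5)], 9, 32, 10000, 1,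
      [(0, 215797), (1, 7188), (3, 3017), (5, 2483), (7, 1712), (11, 2871), (21, 2228), (25, 903),
    (27, 968), (29, 819), (31, 1083), (32, 930)]⟩,
  ⟨1569201000000, 450566572660, [(8, 5), (32, 5)], 9, 16, 10000, 1,
      [(0, 219507), (1, 5562), (2, 3515), (4, 2007), (6, 2477), (10, 1984), (12, 1101), (14,
    1302), (15, 1165), (16, 1379)]⟩,
  ⟨1575111000000, 454325746024, [(8, 5), (32, 5)], 9, 32, 10000, 1,
      [(0, 216855), (1, 8411), (5, 4765), (12, 3037), (20, 2327), (27, 2002), (31, 1562), (32,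
    1040)]⟩,
  ⟨1581162000000, 458160019811, [(8, 5), (32, 5)], 9, 16, 10000, 1,
      [(0, 220459), (1, 5286), (2, 4050), (6, 3273), (10, 2462), (14, 1720), (15, 1222), (16,
    1527)]⟩,
  ⟨1587358000000, 462070999005, [(8, 5), (32, 5)], 9, 16, 10000, 1,
      [(0, 220733), (1, 5532), (2, 3558), (6, 3245), (10, 2446), (14, 1566), (15, 1346), (16,
    1573)]⟩,
  ⟨1593702000000, 466059611863, [(8, 5), (32, 5)], 9, 32, 10000, 1,
      [(0, 218295), (1, 6538), (3, 4798), (12, 3437), (20, 2553), (29, 1901), (31, 1266), (32,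
    1211)]⟩,
  ⟨1600198000000, 470127371629, [(8, 5), (32, 5)], 7, 32, 10000, 1,
      [(0, 222005), (2, 5483), (5, 2555), (12, 3025), (20, 2320), (27, 1241), (30, 1563), (32,
    1807)]⟩,
  ⟨1606849000000, 474275118472, [(8, 5), (32, 5)], 9, 16, 10000, 1,
      [(0, 223070), (1, 6350), (6, 3648), (10, 2667), (15, 2231), (16, 2033)]⟩,
  ⟨1613659000000, 478504271233, [(8, 5), (32, 5)], 9, 32, 10000, 1,
      [(0, 226368), (5, 3750), (12, 2950), (20, 2275), (27, 1701), (32, 2955)]⟩,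
  ⟨1620632000000, 482816196662, [(8, 5), (32, 5)], 7, 32, 10000, 1,
      [(0, 226760), (5, 3402), (12, 2906), (20, 2249), (27, 1589), (32, 3093)]⟩,
  ⟨1626344000000, 486334550905, [(8, 5), (32, 5)], 7, 8, 10000, 1,
      [(0, 226415), (1, 3585), (3, 3068), (5, 2345), (7, 1615), (8, 2971)]⟩,
  ⟨1631023000000, 489207425357, [(8, 5), (32, 5)], 9, 8, 10000, 1,
      [(0, 225793), (1, 4411), (3, 2864), (5, 2224), (7, 1943), (8, 2764)]⟩,
  ⟨1635814000000, 492140539825, [(8, 5), (32, 5)], 9, 32, 10000, 1,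
      [(0, 224823), (3, 4015), (8, 2084), (11, 2146), (21, 1766), (24, 1198), (29, 1493), (32,
    2474)]⟩,
  ⟨1640719000000, 495134560434, [(8, 5), (32, 5)], 9, 32, 10000, 1,
      [(0, 224688), (3, 4171), (8, 2202), (11, 2007), (21, 1671), (24, 1282), (29, 1542), (32,
    2436)]⟩,
  ⟨1644737000000, 497580493055, [(8, 5), (32, 5)], 7, 32, 10000, 1,
      [(0, 224865), (3, 3987), (8, 2437), (11, 1779), (21, 1510), (24, 1447), (29, 1488), (32,
    2486)]⟩,
  ⟨1648851000000, 500078681742, [(8, 5), (32, 5)], 9, 32, 10000, 1,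
      [(0, 224739), (3, 4074), (8, 2138), (10, 2117), (22, 1747), (24, 1229), (29, 1504), (32,
    2451)]⟩,
  ⟨1653063000000, 502629930675, [(8, 5), (32, 5)], 9, 16, 10000, 1,
      [(0, 223584), (1, 4938), (4, 2600), (5, 1946), (11, 1629), (12, 1485), (15, 1665), (16,
    2152)]⟩,
  ⟨1657376000000, 505235628856, [(8, 5), (32, 5)], 9, 16, 10000, 1,
      [(0, 223683), (1, 4892), (4, 2675), (5, 1818), (11, 1538), (12, 1551), (15, 1666), (16,
    2176)]⟩,
  ⟨1661792000000, 507896538220, [(8, 5), (32, 5)], 9, 16, 10000, 1,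
      [(0, 223947), (1, 4616), (4, 2876), (5, 1629), (11, 1401), (12, 1694), (15, 1595), (16,
    2241)]⟩,
  ⟨1666313000000, 510613401288, [(8, 5), (32, 5)], 9, 32, 10000, 1,
      [(0, 221758), (1, 5502), (5, 2594), (9, 3214), (23, 2429), (27, 1221), (31, 1522), (32,
    1759)]⟩,
  ⟨1670942000000, 513387539296, [(8, 5), (32, 5)], 9, 32, 10000, 1,
      [(0, 222224), (1, 5057), (5, 2660), (9, 3127), (23, 2379), (27, 1263), (31, 1438), (32,
    1851)]⟩,
  ⟨1675682000000, 516220246627, [(8, 5), (32, 5)], 9, 8, 10000, 1,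
      [(0, 226417), (1, 2647), (2, 3524), (4, 939), (6, 2393), (7, 1108), (8, 2971)]⟩,
  ⟨1679565000000, 518534831355, [(8, 5), (32, 5)], 7, 16, 10000, 1,
      [(0, 225423), (1, 3147), (4, 4498), (12, 3092), (15, 1190), (16, 2649)]⟩,
  ⟨1683541000000, 520899313386, [(8, 5), (32, 5)], 7, 32, 10000, 1,
      [(0, 225592), (3, 3526), (8, 3950), (24, 2824), (29, 1406), (32, 2701)]⟩,
  ⟨1686798000000, 522832057252, [], 13, 32, 10000, 1,
      [(0, 192732), (3, 4170), (8, 3666), (24, 2677), (29, 1662), (32, 2592)]⟩,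
  ⟨1690133000000, 524807224103, [], 13, 64, 10000, 1,
      [(0, 192829), (6, 4244), (17, 3495), (47, 2585), (58, 1725), (64, 2621)]⟩,
  ⟨1693548000000, 526825736580, [], 13, 64, 10000, 1,
      [(0, 192120), (4, 4699), (17, 3749), (47, 2721), (60, 1792), (64, 2418)]⟩,
  ⟨1697044000000, 528887914064, [], 13, 64, 10000, 1,
      [(0, 192232), (4, 4744), (17, 3592), (47, 2638), (60, 1844), (64, 2449)]⟩,
  ⟨1700623000000, 530994654556, [], 13, 128, 10000, 1,
      [(0, 191708), (7, 5261), (33, 3599), (95, 2641), (121, 1982), (128, 2308)]⟩,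
  ⟨1705204000000, 533684751712, [], 13, 128, 10000, 1,
      [(0, 193154), (12, 3597), (23, 2684), (60, 1133), (68, 1018), (105, 1738), (116, 1455),
    (128, 2720)]⟩,
  ⟨1708206000000, 535443697033, [], 12, 128, 10000, 1,
      [(0, 194754), (21, 5814), (107, 3653), (128, 3278)]⟩,
  ⟨1713009000000, 538251473308, [], 17, 128, 10000, 1,
      [(0, 194791), (21, 4775), (64, 1913), (107, 2727), (128, 3293)]⟩,
  ⟨1716943000000, 540545383966, [], 12, 128, 10000, 1,
      [(0, 195062), (21, 5506), (107, 3531), (128, 3400)]⟩,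
  ⟨1721978000000, 543473630121, [], 12, 64, 10000, 1,
      [(0, 191894), (3, 4480), (10, 3156), (32, 1979), (54, 2005), (61, 1628), (64, 2357)]⟩]
      1531527000000 = true := by
  decide +kernel

theorem checkChain_upTo_1834 :
    checkChain 1834572526764 [
  ⟨1726102000000, 545865687131, [], 12, 128, 10000, 1,
      [(0, 195586), (21, 4982), (107, 3310), (128, 3621)]⟩,
  ⟨1731380000000, 548918778427, [], 12, 128, 10000, 1,
      [(0, 195973), (21, 3564), (64, 1966), (107, 2202), (128, 3794)]⟩,
  ⟨1736784000000, 552035127234, [], 12, 64, 10000, 1,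
      [(0, 196481), (11, 4087), (53, 2893), (64, 4038)]⟩,
  ⟨1742317000000, 555215836656, [], 12, 32, 10000, 1,
      [(0, 196551), (5, 4017), (27, 2858), (32, 4073)]⟩,
  ⟨1749399000000, 559272300418, [], 16, 16, 10000, 1,
      [(0, 194910), (1, 4338), (8, 2486), (15, 2426), (16, 3339)]⟩,
  ⟨1755200000000, 562582810578, [], 16, 2, 10000, 1,
      [(0, 198946), (1, 3018), (2, 5535)]⟩,
  ⟨1761140000000, 565961326678, [], 12, 2, 10000, 1,
      [(0, 199139), (1, 2680), (2, 5680)]⟩,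
  ⟨1767222000000, 569408822158, [], 12, 32, 10000, 1,
      [(0, 196657), (3, 2944), (16, 1849), (29, 1923), (32, 4126)]⟩,
  ⟨1772204000000, 572223969750, [], 12, 8, 10000, 1,
      [(0, 198823), (3, 1745), (5, 1486), (8, 5445)]⟩,
  ⟨1777305000000, 575098172075, [], 12, 64, 10000, 1,
      [(0, 198653), (23, 1915), (41, 1607), (64, 5324)]⟩,
  ⟨1782528000000, 578032581497, [], 12, 128, 10000, 1,
      [(0, 198630), (45, 1938), (83, 1623), (128, 5308)]⟩,
  ⟨1789213000000, 581775858407, [], 15, 64, 10000, 1,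
      [(0, 198691), (23, 1877), (41, 1580), (64, 5351)]⟩,
  ⟨1794689000000, 584831747916, [], 15, 128, 10000, 1,
      [(0, 198658), (45, 1910), (83, 1603), (128, 5328)]⟩,
  ⟨1799174000000, 587327670731, [], 15, 64, 10000, 1,
      [(0, 198489), (21, 2079), (43, 1721), (64, 5210)]⟩,
  ⟨1802848000000, 589367636769, [], 11, 128, 10000, 1,
      [(0, 198471), (41, 2097), (87, 1733), (128, 5198)]⟩,
  ⟨1805857000000, 591035271390, [], 15, 16, 10000, 1,
      [(0, 198394), (5, 2174), (11, 1785), (16, 5146)]⟩,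
  ⟨1807828000000, 592126124741, [], 15, 64, 10000, 1,
      [(0, 198558), (25, 2010), (39, 1673), (64, 5258)]⟩,
  ⟨1809846000000, 593241758825, [], 15, 128, 10000, 1,
      [(0, 198249), (37, 1342), (50, 977), (78, 890), (91, 992), (128, 5049)]⟩,
  ⟨1811499000000, 594154679364, [], 15, 64, 10000, 1,
      [(0, 197900), (14, 1505), (25, 1163), (39, 1042), (50, 1062), (64, 4827)]⟩,
  ⟨1812853000000, 594901847444, [], 15, 128, 10000, 1,
      [(0, 196920), (7, 1338), (33, 1501), (49, 809), (79, 749), (95, 1127), (121, 791), (128,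
    4264)]⟩,
  ⟨1813740000000, 595391011802, [], 15, 128, 10000, 1,
      [(0, 196132), (5, 2062), (33, 2374), (95, 1918), (123, 1144), (128, 3869)]⟩,
  ⟨1814648000000, 595891509554, [], 15, 8, 10000, 1,
      [(0, 197853), (2, 2089), (3, 626), (5, 590), (6, 1543), (8, 4798)]⟩,
  ⟨1815577000000, 596403323571, [], 15, 4, 10000, 1,
      [(0, 197840), (1, 2728), (3, 2141), (4, 4790)]⟩,
  ⟨1816766000000, 597057997451, [], 15, 32, 10000, 1,
      [(0, 195807), (1, 2277), (8, 2484), (24, 1988), (31, 1224), (32, 3719)]⟩,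
  ⟨1817983000000, 597727644816, [], 15, 128, 10000, 1,
      [(0, 197736), (31, 2832), (97, 2205), (128, 4726)]⟩,
  ⟨1819229000000, 598412785000, [], 15, 64, 10000, 1,
      [(0, 197625), (15, 2943), (49, 2271), (64, 4660)]⟩,
  ⟨1820823000000, 599288596720, [], 15, 64, 10000, 1,
      [(0, 197590), (15, 2978), (49, 2292), (64, 4639)]⟩,
  ⟨1822455000000, 600184493277, [], 15, 64, 10000, 1,
      [(0, 197576), (15, 2992), (49, 2300), (64, 4631)]⟩,
  ⟨1824543000000, 601329544757, [], 15, 128, 10000, 1,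
      [(0, 197491), (29, 3077), (99, 2350), (128, 4581)]⟩,
  ⟨1826681000000, 602500659016, [], 15, 128, 10000, 1,
      [(0, 197521), (29, 3047), (99, 2333), (128, 4598)]⟩,
  ⟨1828082000000, 603267329833, [], 15, 32, 10000, 1,
      [(0, 197412), (7, 3156), (25, 2396), (32, 4535)]⟩,
  ⟨1829000000000, 603769369448, [], 15, 32, 10000, 1,
      [(0, 197411), (7, 3157), (25, 2396), (32, 4535)]⟩,
  ⟨1830000000000, 604315966893, [], 15, 64, 10000, 1,
      [(0, 197176), (13, 3392), (51, 2529), (64, 4402)]⟩,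
  ⟨1831265625000, 605007326210, [], 16, 256, 10000, 1,
      [(0, 197111), (51, 3457), (205, 2564), (256, 4367)]⟩,
  ⟨1832266754150, 605553863852, [], 14, 256, 10000, 1,
      [(0, 197110), (51, 3458), (205, 2565), (256, 4366)]⟩,
  ⟨1833058662950, 605985972177, [], 14, 128, 10000, 1,
      [(0, 197090), (25, 3478), (103, 2576), (128, 4355)]⟩,
  ⟨1833685075184, 606327644398, [], 14, 256, 10000, 1,
      [(0, 197005), (49, 3563), (207, 2622), (256, 4309)]⟩,
  ⟨1834180577048, 606597829795, [], 14, 16, 10000, 1,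
      [(0, 196952), (3, 3616), (13, 2650), (16, 4281)]⟩,
  ⟨1834572526764, 606811498966, [], 17, 256, 10000, 1,
      [(0, 196903), (47, 3665), (209, 2676), (256, 4255)]⟩]
      1721978000000 = true := by
  decide +kernel

theorem checkChain_upTo_1839_233 :
    checkChain 1839233474153 [
  ⟨1834985911230, 607036803713, [], 17, 512, 10000, 1,
      [(0, 196349), (57, 1257), (94, 2962), (418, 2283), (455, 675), (512, 3973)]⟩,
  ⟨1835231156408, 607170444407, [], 17, 128, 10000, 1,
      [(0, 196311), (14, 1284), (23, 2973), (105, 2289), (114, 688), (128, 3954)]⟩,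
  ⟨1835425149175, 607276143634, [], 17, 512, 10000, 1,
      [(0, 196275), (57, 1270), (91, 3023), (421, 2318), (455, 676), (512, 3937)]⟩,
  ⟨1835629750921, 607387611183, [], 18, 256, 10000, 1,
      [(0, 196386), (34, 1246), (45, 2936), (211, 2267), (222, 673), (256, 3991)]⟩,
  ⟨1835845541824, 607505161152, [], 18, 256, 10000, 1,
      [(0, 196348), (34, 1354), (45, 2866), (211, 2225), (222, 734), (256, 3972)]⟩,
  ⟨1836073133792, 607629124665, [], 18, 256, 10000, 1,
      [(0, 196321), (34, 1442), (45, 2805), (211, 2188), (222, 784), (256, 3959)]⟩,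
  ⟨1836313172195, 607759850783, [], 18, 256, 10000, 1,
      [(0, 196297), (34, 1553), (45, 2718), (211, 2135), (222, 849), (256, 3947)]⟩,
  ⟨1836566337698, 607897707471, [], 18, 512, 10000, 1,
      [(0, 196260), (68, 1590), (89, 2718), (423, 2135), (444, 866), (512, 3930)]⟩,
  ⟨1836833348189, 608043082609, [], 18, 128, 10000, 1,
      [(0, 196232), (17, 1619), (22, 2717), (106, 2135), (111, 880), (128, 3916)]⟩,
  ⟨1837114960816, 608196385053, [], 18, 128, 10000, 1,
      [(0, 196211), (17, 1717), (22, 2640), (106, 2087), (111, 938), (128, 3906)]⟩,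
  ⟨1837282030807, 608287322418, [], 15, 128, 10000, 1,
      [(0, 196191), (17, 1779), (22, 2598), (106, 2061), (111, 973), (128, 3897)]⟩,
  ⟨1837414185780, 608359249437, [], 16, 128, 10000, 1,
      [(0, 196176), (17, 1837), (22, 2555), (106, 2034), (111, 1008), (128, 3889)]⟩,
  ⟨1837518722428, 608416141169, [], 19, 512, 10000, 1,
      [(0, 196135), (67, 1887), (88, 2546), (424, 2028), (445, 1033), (512, 3870)]⟩,
  ⟨1837665727089, 608496139690, [], 19, 512, 10000, 1,
      [(0, 194957), (18, 1546), (67, 1429), (86, 2636), (426, 2084), (445, 798), (494, 691), (512,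
    3358)]⟩,
  ⟨1837782010072, 608559415237, [], 16, 512, 10000, 1,
      [(0, 194856), (17, 1658), (68, 1472), (86, 2582), (426, 2051), (444, 826), (495, 736), (512,
    3318)]⟩,
  ⟨1837904652280, 608626146828, [], 19, 256, 10000, 1,
      [(0, 194934), (9, 1566), (34, 1513), (43, 2555), (213, 2034), (222, 850), (247, 698), (256,
    3349)]⟩,
  ⟨1838034001483, 608696522977, [], 19, 512, 10000, 1,
      [(0, 194632), (17, 1925), (69, 1533), (86, 2478), (426, 1985), (443, 870), (495, 845), (512,
    3231)]⟩,
  ⟨1838136318723, 608752188101, [], 19, 512, 10000, 1,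
      [(0, 194573), (17, 1954), (68, 1552), (85, 2489), (427, 1992), (444, 878), (495, 852), (512,
    3209)]⟩,
  ⟨1838328163548, 608856551860, [], 17, 2048, 100000, 1,
      [(0, 1945504), (66, 19587), (275, 16418), (341, 24176), (1707, 19454), (1773, 9338), (1982,
    8515), (2048, 32007)]⟩,
  ⟨1838479915802, 608939097508, [], 17, 2048, 100000, 1,
      [(0, 1944159), (64, 20932), (275, 16635), (339, 23959), (1709, 19314), (1773, 9478), (1984,
    9017), (2048, 31505)]⟩,
  ⟨1838599954206, 609004387580, [], 20, 1024, 100000, 1,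
      [(0, 1943777), (34, 21551), (137, 16610), (169, 23747), (855, 19176), (887, 9497), (990,
    9277), (1024, 31364)]⟩,
  ⟨1838671168395, 609043119665, [], 17, 2048, 100000, 1,
      [(0, 1942166), (61, 22804), (268, 16723), (336, 23992), (1712, 19335), (1780, 9517), (1987,
    9685), (2048, 30777)]⟩,
  ⟨1838727499931, 609073756287, [], 18, 512, 100000, 1,
      [(0, 1941788), (15, 23374), (69, 17260), (84, 23263), (428, 18860), (443, 9896), (497,
    9917), (512, 30641)]⟩,
  ⟨1838786912097, 609106067331, [], 21, 2048, 100000, 1,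
      [(0, 1940932), (59, 24230), (276, 17094), (334, 23429), (1714, 18968), (1772, 9788), (1989,
    10222), (2048, 30336)]⟩,
  ⟨1838849573365, 609140144255, [], 18, 1024, 100000, 1,
      [(0, 1940448), (29, 24714), (138, 17272), (167, 23251), (857, 18852), (886, 9904), (995,
    10393), (1024, 30165)]⟩,
  ⟨1838915661421, 609176083501, [], 21, 1024, 100000, 1,
      [(0, 1939789), (29, 25367), (138, 17677), (167, 22852), (857, 18589), (886, 10170), (995,
    10621), (1024, 29934)]⟩,
  ⟨1838967938105, 609204511092, [], 18, 2048, 100000, 1,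
      [(0, 1939197), (57, 25953), (275, 17415), (333, 23120), (1715, 18766), (1773, 9996), (1991,
    10824), (2048, 29728)]⟩,
  ⟨1839023073670, 609234492440, [], 22, 2048, 100000, 1,
      [(0, 1935537), (44, 11696), (57, 17904), (275, 17691), (333, 22857), (1715, 18592), (1773,
    10177), (1991, 7877), (2004, 4177), (2048, 28491)]⟩,
  ⟨1839055783490, 609252278801, [], 22, 16384, 100000, 1,
      [(0, 1938283), (447, 26839), (2208, 17864), (2653, 22699), (13731, 18488), (14176, 10288),
    (15937, 11125), (16384, 29413)]⟩,
  ⟨1839090282128, 609271037512, [], 19, 8192, 100000, 1,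
      [(0, 1934479), (177, 13595), (222, 17053), (1104, 17891), (1325, 22667), (6867, 18467),
    (7088, 10307), (7970, 7546), (8015, 4849), (8192, 28145)]⟩,
  ⟨1839117571089, 609285875695, [], 20, 16384, 100000, 1,
      [(0, 1934064), (355, 14256), (443, 16830), (2208, 17935), (2651, 22600), (13733, 18422),
    (14176, 10340), (15941, 7461), (16029, 5080), (16384, 28011)]⟩,
  ⟨1839139157083, 609297612773, [], 23, 4096, 100000, 1,
      [(0, 1924301), (21, 12141), (88, 11851), (110, 16834), (552, 18049), (662, 22509), (3434,
    18362), (3544, 10412), (3986, 7460), (4008, 4288), (4075, 3744), (4096, 25048)]⟩,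
  ⟨1839156231941, 609306896888, [], 26, 16384, 100000, 1,
      [(0, 1923003), (83, 13366), (355, 12323), (437, 16444), (2207, 18007), (2645, 22542),
    (13739, 18384), (14177, 10385), (15947, 7308), (16029, 4470), (16301, 4086), (16384, 24681)]⟩,
  ⟨1839163829335, 609311027792, [], 20, 16384, 100000, 1,
      [(0, 1922489), (88, 14098), (355, 12358), (443, 16217), (2207, 18058), (2651, 22465),
    (13733, 18332), (14177, 10424), (15941, 7221), (16029, 4497), (16296, 4302), (16384, 24538)]⟩,
  ⟨1839171842211, 609315384587, [], 23, 16384, 100000, 1,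
      [(0, 1921994), (88, 14379), (346, 12525), (443, 16242), (2200, 17984), (2643, 22561),
    (13741, 18396), (14184, 10371), (15941, 7229), (16038, 4549), (16296, 4368), (16384, 24401)]⟩,
  ⟨1839191874401, 609326276489, [], 20, 16384, 1000000, 1,
      [(0, 19219556), (88, 146671), (355, 124949), (443, 160240), (2199, 134314), (2296, 48495),
    (2555, 39126), (2643, 183501), (13741, 154993), (13829, 26985), (14088, 31097), (14185,
    74593), (15941, 71421), (16029, 45535), (16296, 44616), (16384, 243907)]⟩,
  ⟨1839207720176, 609334892070, [], 24, 2048, 1000000, 1,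
      [(0, 19211509), (11, 152533), (43, 122122), (54, 164968), (275, 132157), (287, 50383), (319,
    43911), (330, 179269), (1718, 151965), (1729, 30382), (1761, 32229), (1773, 73234), (1994,
    73260), (2005, 44283), (2037, 46099), (2048, 241695)]⟩,
  ⟨1839220254431, 609341707077, [], 21, 16384, 1000000, 1,
      [(0, 19192515), (75, 170495), (355, 128734), (430, 159572), (2209, 132647), (2293, 62059),
    (2639, 210830), (13745, 174028), (14091, 40134), (14175, 73556), (15954, 71146), (16029,
    46833), (16309, 50886), (16384, 236564)]⟩,
  ⟨1839233474153, 609348894728, [], 21, 16384, 1000000, 1,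
      [(0, 19181382), (74, 181717), (355, 128591), (429, 159712), (2209, 128424), (2283, 53503),
    (2564, 54200), (2638, 169323), (13746, 144762), (13820, 37813), (14101, 34121), (14175,
    70979), (15955, 71210), (16029, 46783), (16310, 53865), (16384, 233614)]⟩]
      1834572526764 = true := by
  decide +kernel

theorem checkChain_upTo_1839_746 :
    checkChain 1839746588133 [
  ⟨1839243931159, 609354580236, [], 22, 16384, 1000000, 1,
      [(0, 19171478), (73, 192141), (355, 130134), (429, 157670), (2209, 125918), (2283, 56524),
    (2564, 56019), (2638, 166968), (13746, 143039), (13820, 39179), (14101, 35991), (14175,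
    69456), (15955, 70400), (16029, 47429), (16311, 56629), (16384, 231024)]⟩,
  ⟨1839252202814, 609359077539, [], 22, 16384, 1000000, 1,
      [(0, 19166423), (72, 197067), (355, 131797), (429, 156101), (2208, 124109), (2283, 58334),
    (2563, 59046), (2638, 163975), (13746, 140838), (13821, 41403), (14101, 37088), (14176,
    68353), (15955, 69772), (16029, 48083), (16312, 57896), (16384, 229714)]⟩,
  ⟨1839258745822, 609362634961, [], 22, 16384, 1000000, 1,
      [(0, 19160339), (71, 202980), (355, 133142), (427, 154920), (2209, 122283), (2281, 60252),
    (2564, 60165), (2636, 162771), (13748, 139949), (13820, 42235), (14103, 38254), (14175,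
    67248), (15957, 69300), (16029, 48608), (16313, 59404), (16384, 228149)]⟩,
  ⟨1839263921443, 609365448928, [], 23, 16384, 1000000, 1,
      [(0, 19156368), (71, 207338), (355, 131638), (426, 156051), (2209, 122113), (2281, 60150),
    (2564, 62909), (2636, 160285), (13748, 138108), (13820, 44248), (14103, 38176), (14175,
    67147), (15958, 69752), (16029, 48034), (16313, 60548), (16384, 227134)]⟩,
  ⟨1839268015440, 609367674814, [], 26, 16384, 1000000, 1,
      [(0, 19123771), (57, 118323), (71, 121536), (355, 132660), (426, 155099), (2209, 120576),
    (2281, 62020), (2564, 63224), (2635, 159643), (13749, 137632), (13820, 44506), (14103, 39326),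
    (14175, 66218), (15958, 69372), (16029, 48437), (16313, 37433), (16327, 31234), (16384,
    218989)]⟩,
  ⟨1839270444251, 609368995345, [], 23, 16384, 1000000, 1,
      [(0, 19121706), (57, 118297), (71, 123961), (355, 131944), (425, 155476), (2209, 119912),
    (2281, 62672), (2563, 64250), (2636, 158634), (13748, 136882), (13821, 45267), (14103, 39718),
    (14175, 65817), (15959, 69522), (16029, 48173), (16313, 38139), (16327, 31145), (16384,
    218484)]⟩,
  ⟨1839272365478, 609370039903, [], 27, 16384, 1000000, 1,
      [(0, 19119430), (57, 121377), (71, 123194), (355, 132436), (426, 154949), (2208, 119656),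
    (2281, 62727), (2563, 65736), (2636, 157347), (13748, 135923), (13821, 46359), (14103, 39737),
    (14176, 65664), (15958, 69312), (16029, 48372), (16313, 37923), (16327, 31928), (16384,
    217929)]⟩,
  ⟨1839273885198, 609370866165, [], 24, 16384, 1000000, 1,
      [(0, 19031203), (14, 111230), (57, 100528), (71, 121024), (355, 132606), (426, 154800),
    (2208, 119541), (2281, 62795), (2563, 66155), (2636, 156970), (13748, 135642), (13821, 46668),
    (14103, 39776), (14176, 65595), (15958, 69253), (16029, 48438), (16313, 37306), (16327,
    26858), (16370, 26036), (16384, 197575)]⟩,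
  ⟨1839275087320, 609371519750, [], 24, 16384, 1000000, 1,
      [(0, 19017428), (12, 122578), (57, 106680), (71, 117202), (355, 133244), (426, 154252),
    (2208, 118929), (2279, 63319), (2565, 66648), (2634, 156572), (13750, 135344), (13819, 47029),
    (14105, 40085), (14176, 65226), (15958, 69033), (16029, 48688), (16313, 36210), (16327,
    28528), (16372, 28413), (16384, 194591)]⟩,
  ⟨1839277341298, 609372745220, [], 24, 16384, 10000000, 1,
      [(0, 190099021), (12, 1305905), (57, 1008567), (69, 1224098), (355, 1336735), (426,
    1539551), (2208, 1187144), (2279, 635044), (2565, 669773), (2634, 1562690), (13750, 1351172),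
    (13819, 472728), (14105, 401943), (14176, 650977), (15958, 689147), (16029, 488506), (16315,
    376882), (16327, 268855), (16372, 301441), (16384, 1929820)]⟩,
  ⟨1839279718540, 609374037706, [], 25, 16384, 10000000, 1,
      [(0, 190033324), (12, 1360837), (57, 1037600), (69, 1205937), (355, 972751), (367, 443321),
    (424, 1460134), (2208, 1184920), (2279, 636749), (2565, 675333), (2634, 1557622), (13750,
    1347383), (13819, 476845), (14105, 402935), (14176, 649644), (15960, 657196), (16017, 173925),
    (16029, 346509), (16315, 371724), (16327, 276738), (16372, 312681), (16384, 1915891)]⟩,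
  ⟨1839281128866, 609374804487, [], 25, 16384, 10000000, 1,
      [(0, 189964481), (12, 1429680), (57, 1052239), (69, 1190710), (355, 954550), (367, 469153),
    (424, 1453073), (2208, 1184672), (2280, 638642), (2565, 678061), (2634, 1553267), (13750,
    1344125), (13819, 479019), (14104, 404179), (14176, 649493), (15960, 654336), (16017, 183914),
    (16029, 339567), (16315, 367356), (16327, 280910), (16372, 327158), (16384, 1901414)]⟩,
  ⟨1839282616319, 609375613201, [], 25, 16384, 10000000, 1,
      [(0, 189996034), (13, 1408526), (57, 1055583), (69, 1176913), (355, 944847), (367, 388980),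
    (412, 402033), (424, 1140863), (2208, 1126710), (2267, 272885), (2280, 423268), (2565,
    466510), (2578, 223869), (2622, 259991), (2634, 1281516), (13750, 1135786), (13762, 199528),
    (13806, 164673), (13819, 323529), (14104, 272522), (14117, 166003), (14176, 614828), (15960,
    525059), (15972, 165416), (16017, 151421), (16029, 335886), (16315, 363414), (16327, 282236),
    (16371, 323136), (16384, 1908034)]⟩,
  ⟨1839283792917, 609376252906, [], 26, 16384, 10000000, 1,
      [(0, 189545647), (9, 1796926), (57, 1133394), (69, 1160768), (355, 940803), (367, 390866),
    (412, 435572), (424, 1109799), (2208, 941461), (2224, 237594), (2267, 248574), (2281, 395818),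
    (2565, 446667), (2577, 240364), (2622, 302127), (2634, 1242148), (13750, 1104763), (13762,
    232626), (13807, 176472), (13819, 309268), (14103, 255440), (14117, 152193), (14160, 139918),
    (14176, 506191), (15960, 511881), (15972, 179583), (16017, 152083), (16029, 334340), (16315,
    358781), (16327, 302197), (16375, 399855), (16384, 1815880)]⟩,
  ⟨1839284000000, 609376365495, [], 26, 16384, 10000000, 1,
      [(0, 189467424), (9, 1879351), (57, 1131947), (69, 1158334), (355, 1229066), (412, 571891),
    (424, 1075771), (2208, 1185404), (2281, 637958), (2565, 621872), (2622, 387510), (2634,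
    1222000), (13750, 1088801), (13762, 297213), (13819, 437166), (14103, 403764), (14176,
    649923), (15960, 497379), (15972, 234688), (16029, 445717), (16315, 358099), (16327, 301944),
    (16375, 416400), (16384, 1800377)]⟩,
  ⟨1839284750000, 609376773262, [], 27, 16384, 10000000, 1,
      [(0, 189457855), (9, 1889975), (57, 1128257), (69, 1160929), (355, 907459), (367, 426470),
    (412, 467209), (424, 1075645), (2208, 908801), (2223, 335855), (2279, 577894), (2565, 433703),
    (2577, 256040), (2622, 323512), (2634, 1218924), (13750, 1086359), (13762, 249652), (13807,
    187787), (13819, 299913), (14105, 367461), (14161, 198319), (14176, 487368), (15960, 497327),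
    (15972, 193133), (16017, 165590), (16029, 321755), (16315, 358841), (16327, 300927), (16375,
    418549), (16384, 1798490)]⟩,
  ⟨1839285541015, 609377203329, [], 27, 16384, 100000000, 1,
      [(0, 1894194598), (9, 13219683), (13, 6648119), (57, 10716844), (69, 11591721), (355,
    9000928), (367, 4348711), (412, 4708588), (424, 10709245), (2208, 9003237), (2223, 2773742),
    (2267, 2635213), (2280, 3821263), (2565, 4252321), (2577, 2648686), (2622, 3353444), (2634,
    12058938), (13750, 10759995), (13762, 2591131), (13807, 1941558), (13819, 2938829), (14104,
    2468763), (14117, 1615075), (14161, 1628008), (14176, 4825016), (15960, 4953126), (15972,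
    1947233), (16017, 1687807), (16029, 3189837), (16315, 3583409), (16327, 2869028), (16371,
    1595319), (16375, 2811158), (16384, 17909426)]⟩,
  ⟨1839286166720, 609377543518, [], 28, 16384, 100000000, 1,
      [(0, 1886293035), (2, 9456813), (9, 8889829), (11, 9354511), (57, 10872386), (69, 11503722),
    (355, 8916054), (367, 4428986), (412, 4847952), (424, 10575505), (2208, 8525832), (2221,
    3252717), (2267, 2694706), (2280, 3760568), (2565, 4217249), (2577, 2689024), (2622, 3473839),
    (2634, 11932553), (13750, 10659281), (13762, 2687352), (13807, 1970650), (13819, 2913747),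
    (14104, 2430776), (14117, 1652389), (14163, 1902036), (14176, 4551966), (15960, 4895922),
    (15972, 2006722), (16017, 1717892), (16029, 3157868), (16315, 3558161), (16327, 2911101),
    (16373, 2206327), (16375, 1875207), (16382, 1787016), (16384, 16430305)]⟩,
  ⟨1839286661662, 609377812612, [], 29, 16384, 100000000, 1,
      [(0, 1884550444), (2, 11327080), (9, 7289695), (11, 10896478), (57, 10901472), (69,
    11405395), (355, 8846001), (367, 4509772), (412, 4913405), (424, 10499641), (2209, 8611018),
    (2221, 3159854), (2267, 2540652), (2278, 3917963), (2565, 4214620), (2577, 2807256), (2624,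
    3960134), (2634, 11334401), (13750, 10179506), (13760, 3083139), (13807, 2059202), (13819,
    2911680), (14106, 2529128), (14117, 1555792), (14163, 1848871), (14175, 4600584), (15960,
    4863451), (15972, 2035088), (16017, 1748526), (16029, 3131544), (16315, 3529963), (16327,
    2922017), (16373, 2548441), (16375, 1524933), (16382, 2120555), (16384, 16122298)]⟩,
  ⟨1839287053168, 609378025470, [], 29, 16384, 100000000, 1,
      [(0, 1882687974), (2, 13146474), (9, 8206650), (11, 10021743), (57, 10584864), (68,
    11717451), (355, 8882319), (367, 4466932), (412, 4988513), (424, 10436051), (2209, 8588844),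
    (2221, 3192469), (2267, 2513887), (2278, 3936248), (2565, 4191096), (2577, 2717631), (2622,
    3680052), (2634, 11726083), (13750, 10494257), (13762, 2852183), (13807, 1991136), (13819,
    2894919), (14106, 2540619), (14117, 1539316), (14163, 1867773), (14175, 4587905), (15960,
    4836142), (15972, 2066963), (16017, 1732138), (16029, 3144963), (16316, 3619115), (16327,
    2831276), (16373, 2356203), (16375, 1725576), (16382, 2434234), (16384, 15800000)]⟩,
  ⟨1839287466084, 609378249968, [], 29, 16384, 100000000, 1,
      [(0, 1882173962), (2, 16174834), (11, 15889346), (58, 10903690), (68, 11229934), (355,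
    8582314), (366, 4782819), (412, 4712109), (423, 10689251), (2210, 8466216), (2220, 3293211),
    (2267, 2338119), (2277, 4124515), (2565, 4008486), (2576, 2943563), (2623, 3836372), (2633,
    11536540), (13751, 10342220), (13761, 2979292), (13808, 2153742), (13819, 2763973), (14107,
    2657636), (14117, 1429124), (14164, 1924504), (14174, 4517973), (15961, 4944564), (15972,
    1949188), (16018, 1851202), (16029, 3032693), (16316, 3479588), (16326, 2929129), (16373,
    3615046), (16382, 3032561), (16384, 15712283)]⟩,
  ⟨1839288046747, 609378565667, [], 28, 8192, 100000000, 1,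
      [(0, 1882438928), (1, 13964051), (5, 17627567), (29, 11414480), (34, 10936361), (178,
    8934058), (183, 4461816), (206, 5072780), (212, 10287150), (1105, 8340307), (1110, 3435276),
    (1133, 2160686), (1138, 4275046), (1283, 4246292), (1288, 2722143), (1311, 3304580), (1316,
    5037104), (1317, 7026656), (6875, 6565168), (6876, 4198665), (6881, 2554247), (6904, 1995671),
    (6909, 2933350), (7054, 2750744), (7059, 1319091), (7082, 2005774), (7087, 4446288), (7980,
    4772044), (7986, 2105022), (8009, 1731724), (8014, 3165115), (8158, 3395384), (8163, 3068491),
    (8187, 3959596), (8191, 2590910), (8192, 15757434)]⟩,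
  ⟨1839289135490, 609379157604, [], 27, 16384, 100000000, 1,
      [(0, 1875932179), (1, 19249497), (10, 18901004), (58, 10640455), (67, 11617975), (356,
    9056808), (366, 4413615), (413, 5093233), (423, 10234183), (2210, 8143989), (2220, 3665478),
    (2267, 2138677), (2277, 4288957), (2566, 4354757), (2576, 2536039), (2623, 4235544), (2633,
    11182891), (13751, 10057157), (13761, 3298509), (13808, 1860586), (13818, 3012489), (14107,
    2760635), (14117, 1306170), (14164, 2137542), (14174, 4335031), (15961, 4749377), (15971,
    2114845), (16018, 1714398), (16028, 3209588), (16317, 3589524), (16326, 2847893), (16374,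
    4216801), (16383, 3416136), (16384, 14688037)]⟩,
  ⟨1839290666534, 609379990015, [], 26, 16384, 10000000, 1,
      [(0, 189322561), (10, 2084825), (58, 1040857), (67, 1186700), (356, 884224), (365, 442882),
    (413, 591392), (423, 960387), (2210, 812691), (2220, 411213), (2277, 601611), (2566, 625021),
    (2623, 532234), (2633, 1071930), (13751, 968070), (13761, 413980), (13818, 439665), (14107,
    382003), (14164, 240596), (14174, 432531), (15961, 447680), (15971, 246350), (16019, 171557),
    (16028, 312923), (16317, 366108), (16326, 278132), (16374, 459829), (16384, 1772047)]⟩,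
  ⟨1839292819564, 609381160590, [], 26, 16384, 10000000, 1,
      [(0, 189291379), (10, 2097100), (57, 974911), (67, 1272161), (356, 1239769), (413, 756270),
    (423, 881842), (2210, 777523), (2220, 450577), (2277, 597927), (2566, 627657), (2623, 587162),
    (2633, 1014250), (13751, 920786), (13761, 459222), (13818, 441629), (14107, 379784), (14164,
    262977), (14174, 412645), (15961, 413349), (15971, 314915), (16028, 449846), (16317, 390388),
    (16327, 258776), (16374, 461141), (16384, 1766013)]⟩,
  ⟨1839295847262, 609382806710, [], 25, 16384, 10000000, 1,
      [(0, 189235534), (10, 2142135), (57, 1018821), (67, 1238347), (356, 1345429), (422,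
    1535876), (2215, 1162650), (2272, 653452), (2566, 636980), (2623, 530575), (2632, 1068729),
    (13752, 965459), (13761, 412984), (13818, 448003), (14112, 412730), (14169, 636512), (15962,
    687901), (16028, 491801), (16317, 380790), (16327, 270832), (16374, 469197), (16384,
    1755262)]⟩,
  ⟨1839300104962, 609385121560, [], 24, 8192, 10000000, 1,
      [(0, 189170778), (5, 2218190), (29, 1075706), (33, 1177412), (180, 1403984), (211, 1467380),
    (1105, 1102083), (1136, 723574), (1285, 754929), (1316, 1474492), (6876, 1284756), (6907,
    537116), (7056, 454991), (7087, 600171), (7981, 660082), (8012, 515858), (8159, 363796),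
    (8163, 287425), (8187, 484392), (8192, 1742884)]⟩,
  ⟨1839306092352, 609388376810, [], 24, 8192, 1000000, 1,
      [(0, 18908925), (5, 233746), (31, 220037), (180, 144146), (211, 144507), (1105, 107955),
    (1136, 74893), (1285, 77552), (1316, 145091), (6876, 126683), (6907, 55306), (7056, 47021),
    (7087, 58686), (7981, 65106), (8012, 52996), (8161, 63678), (8187, 50928), (8192, 172743)]⟩,
  ⟨1839314512119, 609392954486, [], 23, 8192, 1000000, 1,
      [(0, 19108636), (31, 253578), (180, 147865), (211, 141170), (1105, 107630), (1136, 75282),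
    (1285, 80915), (1316, 141776), (6876, 124150), (6907, 57871), (7056, 47247), (7087, 58484),
    (7981, 63740), (8012, 54470), (8161, 71867), (8192, 215318)]⟩,
  ⟨1839326352416, 609399391807, [], 22, 8192, 1000000, 1,
      [(0, 19122557), (33, 242470), (182, 135974), (206, 149874), (1107, 113544), (1136, 69871),
    (1285, 78750), (1315, 143812), (6877, 125708), (6907, 56227), (7056, 44049), (7085, 61955),
    (7986, 67227), (8010, 49859), (8159, 69430), (8192, 218692)]⟩,
  ⟨1839343002833, 609408444220, [], 22, 4096, 1000000, 1,
      [(0, 19098737), (15, 261889), (90, 146746), (105, 144108), (553, 106934), (568, 76582),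
    (642, 74713), (657, 147143), (3439, 128244), (3454, 53219), (3528, 48080), (3543, 58093),
    (3991, 64956), (4006, 53898), (4081, 73702), (4096, 212955)]⟩,
  ⟨1839366417481, 609421174037, [], 21, 4096, 1000000, 1,
      [(0, 19093755), (15, 266273), (90, 137209), (103, 153672), (553, 168258), (642, 99483),
    (657, 138202), (3439, 121402), (3454, 70499), (3543, 96021), (3993, 68753), (4006, 50013),
    (4081, 74683), (4096, 211776)]⟩,
  ⟨1839399344329, 609439075067, [], 21, 2048, 1000000, 1,
      [(0, 19081507), (7, 272927), (45, 159762), (52, 137248), (277, 169903), (321, 96352), (328,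
    139153), (1720, 122135), (1727, 68344), (1771, 97175), (1996, 62156), (2003, 58727), (2041,
    75701), (2048, 208909)]⟩,
  ⟨1839434071864, 609457954712, [], 20, 2048, 100000, 1,
      [(0, 1906172), (7, 29679), (45, 15740), (52, 13677), (280, 19247), (328, 21170), (1720,
    17462), (1768, 11241), (1996, 6207), (2003, 5809), (2041, 8159), (2048, 20436)]⟩,
  ⟨1839482907460, 609484503610, [], 20, 2048, 100000, 1,
      [(0, 1905324), (7, 33479), (51, 26437), (280, 19353), (328, 21092), (1720, 17409), (1768,
    11308), (1997, 11005), (2041, 9347), (2048, 20245)]⟩,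
  ⟨1839500000000, 609493795602, [], 16, 2048, 100000, 1,
      [(0, 1907157), (7, 31456), (51, 26953), (283, 18630), (324, 21489), (1724, 17678), (1765,
    10876), (1997, 11233), (2041, 8866), (2048, 20661)]⟩,
  ⟨1839556250000, 609524374096, [], 19, 512, 100000, 1,
      [(0, 1933103), (12, 31939), (70, 18709), (81, 21934), (431, 17978), (442, 10838), (500,
    12796), (512, 27702)]⟩,
  ⟨1839635351562, 609567373522, [], 19, 512, 100000, 1,
      [(0, 1932910), (12, 32159), (70, 18914), (81, 21702), (431, 17822), (442, 10981), (500,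
    12871), (512, 27640)]⟩,
  ⟨1839746588133, 609627838335, [], 18, 512, 100000, 1,
      [(0, 1932793), (12, 32270), (70, 19218), (81, 21404), (431, 17621), (442, 11185), (500,
    12905), (512, 27603)]⟩]
      1839233474153 = true := by
  decide +kernel

theorem checkChain_upTo_2000 :
    checkChain 2000000000000 [
  ⟨1839903014560, 609712860793, [], 18, 256, 100000, 1,
      [(0, 1932552), (6, 32598), (35, 19045), (40, 21490), (216, 17679), (221, 11083), (250,
    13025), (256, 27527)]⟩,
  ⟨1840122989222, 609832411395, [], 17, 256, 100000, 1,
      [(0, 1932848), (6, 32140), (35, 19801), (40, 20896), (216, 17275), (221, 11568), (250,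
    12850), (256, 27621)]⟩,
  ⟨1840432328590, 610000505252, [], 17, 512, 100000, 1,
      [(0, 1929852), (11, 34940), (69, 18835), (80, 22058), (432, 18061), (443, 10880), (501,
    13687), (512, 26686)]⟩,
  ⟨1840758584954, 610177761130, [], 19, 512, 10000, 1,
      [(0, 193013), (11, 3426), (69, 2073), (80, 2056), (432, 1705), (443, 1209), (501, 1340),
    (512, 2677)]⟩,
  ⟨1841102683462, 610364676651, [], 16, 256, 10000, 1,
      [(0, 193107), (5, 3340), (35, 2302), (40, 1819), (216, 1539), (221, 1371), (251, 1315),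
    (256, 2706)]⟩,
  ⟨1841586571988, 610627467506, [], 16, 512, 10000, 1,
      [(0, 192966), (9, 3445), (70, 2101), (78, 2056), (434, 1705), (442, 1223), (503, 1341),
    (512, 2662)]⟩,
  ⟨1842096923167, 610904554929, [], 18, 64, 10000, 1,
      [(0, 192925), (1, 3524), (9, 4119), (55, 2909), (63, 1372), (64, 2650)]⟩,
  ⟨1842814604512, 611294079262, [], 15, 64, 10000, 1,
      [(0, 193698), (1, 2715), (9, 4155), (55, 2927), (63, 1107), (64, 2897)]⟩,
  ⟨1843823843903, 611841591274, [], 18, 256, 10000, 1,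
      [(0, 196012), (35, 4556), (221, 3119), (256, 3812)]⟩,
  ⟨1845243086796, 612611023214, [], 17, 256, 10000, 1,
      [(0, 196051), (35, 4517), (221, 3100), (256, 3831)]⟩,
  ⟨1846739944534, 613421892499, [], 14, 128, 10000, 1,
      [(0, 196119), (17, 4449), (111, 3069), (128, 3862)]⟩,
  ⟨1848318661679, 614276394367, [], 13, 128, 10000, 1,
      [(0, 196147), (17, 4421), (111, 3055), (128, 3876)]⟩,
  ⟨1850000000000, 615185639130, [], 13, 512, 10000, 1,
      [(0, 196322), (65, 4246), (447, 2971), (512, 3960)]⟩,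
  ⟨1852097000000, 616318510702, [], 14, 8, 10000, 1,
      [(0, 196613), (1, 3955), (7, 2827), (8, 4104)]⟩,
  ⟨1854657000000, 617699773341, [], 14, 64, 10000, 1,
      [(0, 196266), (7, 4302), (57, 2999), (64, 3932)]⟩,
  ⟨1857278000000, 619111975029, [], 14, 16, 10000, 1,
      [(0, 195638), (1, 4930), (15, 3288), (16, 3643)]⟩,
  ⟨1861471000000, 621367035415, [], 14, 64, 10000, 1,
      [(0, 196256), (5, 3749), (32, 1096), (59, 2470), (64, 3928)]⟩,
  ⟨1865764000000, 623670620726, [], 11, 2, 10000, 1,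
      [(0, 199615), (1, 1823), (2, 6061)]⟩,
  ⟨1871259000000, 626611466399, [], 14, 1, 10000, 1,
      [(0, 200568), (1, 6931)]⟩,
  ⟨1876885000000, 629613487786, [], 11, 1, 10000, 1,
      [(0, 200568), (1, 6931)]⟩,
  ⟨1882646000000, 632678234165, [], 14, 1, 10000, 1,
      [(0, 200568), (1, 6931)]⟩,
  ⟨1887365000000, 635181676444, [], 14, 1, 10000, 1,
      [(0, 200568), (1, 6931)]⟩,
  ⟨1892197000000, 637738587870, [], 14, 16, 10000, 1,
      [(0, 198021), (1, 2547), (15, 2029), (16, 4902)]⟩,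
  ⟨1897144000000, 640349597442, [], 14, 1, 10000, 1,
      [(0, 200568), (1, 6931)]⟩,
  ⟨1902209000000, 643015842458, [], 10, 1, 10000, 1,
      [(0, 200568), (1, 6931)]⟩,
  ⟨1907395000000, 645738436829, [], 14, 1, 10000, 1,
      [(0, 200568), (1, 6931)]⟩,
  ⟨1912705000000, 648518470556, [], 14, 32, 10000, 1,
      [(0, 199452), (9, 1116), (23, 1004), (32, 5927)]⟩,
  ⟨1917054000000, 650789632720, [], 10, 1, 10000, 1,
      [(0, 200568), (1, 6931)]⟩,
  ⟨1922620000000, 653688839215, [], 10, 1, 10000, 1,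
      [(0, 200568), (1, 6931)]⟩,
  ⟨1928319000000, 656648638973, [], 10, 32, 10000, 1,
      [(0, 199290), (5, 1278), (27, 1133), (32, 5798)]⟩,
  ⟨1934154000000, 659670021615, [], 14, 1, 10000, 1,
      [(0, 200568), (1, 6931)]⟩,
  ⟨1943490000000, 664485325980, [], 13, 1, 10000, 1,
      [(0, 200568), (1, 6931)]⟩,
  ⟨1953050000000, 669392253245, [], 10, 1, 10000, 1,
      [(0, 200568), (1, 6931)]⟩,
  ⟨1965286000000, 675637781844, [], 13, 1, 10000, 1,
      [(0, 200568), (1, 6931)]⟩,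
  ⟨1977815000000, 681992700049, [], 10, 1, 10000, 1,
      [(0, 200568), (1, 6931)]⟩,
  ⟨1993852000000, 690068446157, [], 10, 1, 10000, 1,
      [(0, 200568), (1, 6931)]⟩,
  ⟨2000000000000, 693147180599, [], 10, 1, 10000, 1,
      [(0, 200568), (1, 6931)]⟩]
      1839746588133 = true := by
  decide +kernel

/-- The dimension bound in Frostman form on the range of parameters covered by certificates. -/
theorem isFrostman_of_le {β : ℝ} (h₁ : 1.414 ≤ β) (h₂ : β < 2) :
    IsFrostman (coin.map (piBeta β)) 0.98040856 := by
  have hβ : 1 < β := by linarith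
  have hS : (fpUnit : ℝ) = 1000000000000 := by norm_num [fpUnit]
  have h0 : ((1414000000000 : ℕ) : ℝ) ≤ β * fpUnit := by rw [hS]; push_cast; linarith
  rcases lt_or_ge (β * fpUnit) ((1531527000000 : ℕ) : ℝ) with h | h1
  · exact isFrostman_of_checkChain checkChain_upTo_1531 hβ h₂ h0 h
  rcases lt_or_ge (β * fpUnit) ((1721978000000 : ℕ) : ℝ) with h | h2
  · exact isFrostman_of_checkChain checkChain_upTo_1721 hβ h₂ h1 h
  rcases lt_or_ge (β * fpUnit) ((1834572526764 : ℕ) : ℝ) with h | h3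
  · exact isFrostman_of_checkChain checkChain_upTo_1834 hβ h₂ h2 h
  rcases lt_or_ge (β * fpUnit) ((1839233474153 : ℕ) : ℝ) with h | h4
  · exact isFrostman_of_checkChain checkChain_upTo_1839_233 hβ h₂ h3 h
  rcases lt_or_ge (β * fpUnit) ((1839746588133 : ℕ) : ℝ) with h | h5
  · exact isFrostman_of_checkChain checkChain_upTo_1839_746 hβ h₂ h4 h
  exact isFrostman_of_checkChain checkChain_upTo_2000 hβ h₂ h5 (by rw [hS]; push_cast; linarith)

theorem isFrostman_piBeta {β : ℝ} (h₁ : 1 < β) (h₂ : β < 2) :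
    IsFrostman (coin.map (piBeta β)) 0.98040856 := by
  obtain ⟨n, hn⟩ := pow_unbounded_of_one_lt 1.414 h₁
  induction n generalizing β with
  | zero => norm_num at hn
  | succ n ih =>
    rcases le_or_gt 1.414 β with h | h
    · exact isFrostman_of_le h h₂
    · refine isFrostman_piBeta_of_sq h₁ (ih (by nlinarith) (by nlinarith) ?_)
      have hn0 : n ≠ 0 := by
        rintro rfl
        rw [zero_add, pow_one] at hn
        linarith
      rw [← pow_mul]
      exact hn.trans_le (pow_le_pow_right₀ h₁.le (by omega))

theorem stmt2 (β : ℝ) (hβ1 : 1 < β) (hβ2 : β < 2)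
    (m : Measure (ℕ → Fin 2)) (hm : IsCoinMeasure m) :
    ∀ᵐ x ∂(m.map (piBeta β)),
      (0.98040856 : ℝ) ≤
        liminf (fun r : ℝ =>
          Real.log (((m.map (piBeta β)) (Metric.closedBall x r)).toReal) / Real.log r)
          (𝓝[>] 0) := by
  rw [hm.eq_coin]
  have : IsProbabilityMeasure (coin.map (piBeta β)) :=
    Measure.isProbabilityMeasure_map (measurable_piBeta hβ1).aemeasurable
  exact (isFrostman_piBeta hβ1 hβ2).ae_le_liminf (by norm_num) hβ1
    (ae_pow_le_measure_closedBall hβ1)
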